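/- arXiv:1012.0936 — 3 statements merged into one kernel-verified Lean document; each statement's English description precedes it below -/
import Mathlib

section
/- For every ε > 0, P(|Y̲(u)/u + 1| > ε) → 0 as u → ∞; that is, inf_{s∈[0,u]} (X(s) − s), divided by u, converges in probability to −1. -/
open MeasureTheory ProbabilityTheory Filter Set

lemma aux_path_bdd (x : ℝ → ℝ) (h : ∀ t : ℝ, 0 ≤ t →
      ContinuousWithinAt x (Set.Ici t) t ∧
      (0 < t → ∃ l : ℝ, Tendsto x (nhdsWithin t (Set.Iio t)) (nhds l))) (u : ℝ) :
    ∃ C, ∀ s ∈ Icc (0:ℝ) u, |x s| ≤ C := by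
  refine isCompact_Icc.induction_on (p := fun S => ∃ C, ∀ s ∈ S, |x s| ≤ C) ⟨0, by simp⟩ ?_ ?_ ?_
  · rintro s t hst ⟨C, hC⟩
    exact ⟨C, fun y hy => hC y (hst hy)⟩
  · rintro s t ⟨C, hC⟩ ⟨D, hD⟩
    refine ⟨max C D, ?_⟩
    rintro y (hy | hy)
    · exact (hC y hy).trans (le_max_left _ _)
    · exact (hD y hy).trans (le_max_right _ _)
  · intro t ht
    obtain ⟨hr, hl⟩ := h t ht.1
    have key : ∀ (F : Filter ℝ) (l : ℝ), Tendsto x F (nhds l) → ∃ C, ∀ᶠ s in F, |x s| ≤ C := by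
      intro F l hF
      exact ⟨|l| + 1, (hF.abs.eventually (eventually_lt_nhds (lt_add_one |l|))).mono
        fun _ hh => hh.le⟩
    obtain ⟨C, hC⟩ := key _ _ hr
    have hL : ∃ D, ∀ᶠ s in nhdsWithin t (Icc 0 u ∩ Iio t), |x s| ≤ D := by
      rcases ht.1.eq_or_lt with h0 | h0
      · refine ⟨0, ?_⟩
        have : Icc 0 u ∩ Iio t = ∅ := by
          ext y; simp only [mem_inter_iff, mem_Icc, mem_Iio, mem_empty_iff_false, iff_false]
          rintro ⟨⟨h1, _⟩, h2⟩; linarith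
        rw [this]; simp
      · obtain ⟨l, hl⟩ := hl h0
        obtain ⟨D, hD⟩ := key _ _ hl
        exact ⟨D, hD.filter_mono (nhdsWithin_mono _ inter_subset_right)⟩
    obtain ⟨D, hD⟩ := hL
    refine ⟨{s | |x s| ≤ max C D}, ?_, ⟨max C D, fun s hs => hs⟩⟩
    have hsub : Icc 0 u ⊆ (Icc 0 u ∩ Iio t) ∪ Ici t := by
      intro y hy
      rcases lt_or_ge y t with h1 | h1
      · exact Or.inl ⟨hy, h1⟩
      · exact Or.inr h1
    refine nhdsWithin_mono _ hsub ?_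
    rw [nhdsWithin_union]
    refine mem_sup.2 ⟨?_, ?_⟩
    · filter_upwards [hD] with s hs using hs.trans (le_max_right _ _)
    · filter_upwards [hC] with s hs using hs.trans (le_max_left _ _)

lemma aux_grid (x : ℝ → ℝ) (u s c : ℝ) (hu : 0 < u) (hs : s ∈ Icc 0 u)
    (hx : ContinuousWithinAt x (Set.Ici s) s) (hc : c < |x s|) :
    ∃ m k : ℕ, k ≤ 2 ^ m ∧ c < |x (k * (u / 2 ^ m))| := by
  rcases hs.2.eq_or_lt with h1 | h1
  · exact ⟨0, 1, by simp, by simpa [← h1] using hc⟩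
  have h2 : ∀ᶠ y in nhdsWithin s (Ici s), c < |x y| :=
    (hx.abs).eventually (eventually_gt_nhds hc)
  rw [eventually_nhdsWithin_iff, Metric.eventually_nhds_iff] at h2
  obtain ⟨δ, hδ, h2⟩ := h2
  obtain ⟨m, hm⟩ := exists_pow_lt_of_lt_one (div_pos hδ hu) (by norm_num : (1/2:ℝ) < 1)
  have hp : (0:ℝ) < 2 ^ m := by positivity
  have hm' : u / 2 ^ m < δ := by
    rw [div_pow, one_pow, div_lt_div_iff₀ hp hu] at hm
    rw [div_lt_iff₀ hp]; linarith
  have hq : 0 < u / 2 ^ m := by positivity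
  refine ⟨m, ⌈s / (u / 2 ^ m)⌉₊, ?_, ?_⟩
  · rw [Nat.ceil_le]
    push_cast
    rw [div_le_iff₀ hq]
    rw [mul_div_cancel₀ _ hp.ne']; exact hs.2
  · have e1 := Nat.le_ceil (s / (u / 2 ^ m))
    have e2 := Nat.ceil_lt_add_one (div_nonneg hs.1 hq.le)
    rw [div_le_iff₀ hq] at e1
    have e3 : (⌈s / (u / 2 ^ m)⌉₊ : ℝ) * (u / 2 ^ m) < s + u / 2 ^ m := by
      have := mul_lt_mul_of_pos_right e2 hq
      rwa [add_mul, one_mul, div_mul_cancel₀ _ hq.ne'] at this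
    apply h2 _ e1
    rw [Real.dist_eq, abs_of_nonneg (by linarith)]
    linarith

lemma aux_measA {Ω : Type*} [MeasurableSpace Ω] (D : ℕ → Ω → ℝ) (c : ℝ) (k : ℕ)
    (h : ∀ j ≤ k, Measurable (D j)) :
    MeasurableSet {ω | (∀ j < k, |D j ω| ≤ c) ∧ c < |D k ω|} := by
  apply MeasurableSet.inter
  · have : {ω | ∀ j < k, |D j ω| ≤ c} = ⋂ j, ⋂ (_ : j < k), {ω | |D j ω| ≤ c} := by
      ext; simp
    change MeasurableSet {ω | ∀ j < k, |D j ω| ≤ c}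
    rw [this]
    exact MeasurableSet.iInter fun j => MeasurableSet.iInter fun hj =>
      measurableSet_le (measurable_norm.comp (h j hj.le)) measurable_const
  · exact measurableSet_lt measurable_const (measurable_norm.comp (h k le_rfl))

lemma aux_indep {Ω : Type*} [MeasurableSpace Ω] {μ : Measure Ω} [IsProbabilityMeasure μ]
    (X : ℝ → Ω → ℝ) (hmeas : ∀ t : ℝ, Measurable (X t))
    (hincr : ∀ (n : ℕ) (t : Fin (n + 1) → ℝ), (∀ i, 0 ≤ t i) → StrictMono t →
      iIndepFun
        (fun i : Fin n => fun ω => X (t i.succ) ω - X (t i.castSucc) ω) μ)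
    (t : ℕ → ℝ) (ht : StrictMono t) (ht0 : t 0 = 0) (N k : ℕ) (hk : k < N) (a c : ℝ) :
    μ ({ω | (∀ j < k, |X (t j) ω - X 0 ω| ≤ c) ∧ c < |X (t k) ω - X 0 ω|} ∩
        {ω | |X (t N) ω - X (t k) ω| ≤ a}) =
    μ {ω | (∀ j < k, |X (t j) ω - X 0 ω| ≤ c) ∧ c < |X (t k) ω - X 0 ω|} *
      μ {ω | |X (t N) ω - X (t k) ω| ≤ a} := by
  set t' : Fin (k + 1 + 1) → ℝ := fun i => if (i : ℕ) ≤ k then t i else t N with ht'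
  have hnn : ∀ j, 0 ≤ t j := fun j => ht0 ▸ ht.monotone (Nat.zero_le j)
  have hpos : ∀ i, 0 ≤ t' i := by
    intro i; simp only [ht']; split_ifs <;> exact hnn _
  have hmono : StrictMono t' := by
    intro i j hij
    have hij' : (i : ℕ) < j := hij
    have := j.2
    simp only [ht']
    split_ifs
    · exact ht hij'
    · exact ht (by omega)
    · omega
    · omega
  have hI := hincr (k + 1) t' hpos hmono
  set f : Fin (k + 1) → Ω → ℝ := fun i => fun ω => X (t' i.succ) ω - X (t' i.castSucc) ω with hf
  have hfm : ∀ i, Measurable (f i) := fun i => (hmeas _).sub (hmeas _)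
  have hII := indep_iSup_of_disjoint (fun i => (hfm i).comap_le) hI
    (S := {i | i ≠ Fin.last k}) (T := {Fin.last k}) (by simp)
  rw [Indep_iff] at hII
  refine hII _ _ ?_ ?_
  · refine @aux_measA Ω (⨆ i ∈ {i | i ≠ Fin.last k}, MeasurableSpace.comap (f i) Real.measurableSpace) (fun j ω => X (t j) ω - X 0 ω) c k ?_
    intro j
    induction j with
    | zero => intro _; simp only [ht0, sub_self]; exact measurable_const
    | succ j ih =>
      intro hj
      have h1 := ih (by omega)
      have h2 : @Measurable _ _ (⨆ i ∈ {i | i ≠ Fin.last k}, MeasurableSpace.comap (f i) Real.measurableSpace) _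
          (f ⟨j, by omega⟩) := by
        refine (comap_measurable (f ⟨j, by omega⟩)).mono
          (le_iSup₂_of_le (f := fun i (_ : i ∈ {i | i ≠ Fin.last k}) => MeasurableSpace.comap (f i) Real.measurableSpace) ⟨j, by omega⟩ ?_ le_rfl) le_rfl
        simp [Fin.ext_iff]; omega
      convert h1.add h2 using 1
      ext ω
      simp only [hf, ht', Pi.add_apply, Fin.succ_mk, Fin.castSucc_mk, hj, if_true, (by omega : j ≤ k)]
      ring
  · have h2 : @Measurable _ _ (⨆ i ∈ ({Fin.last k} : Set (Fin (k+1))), MeasurableSpace.comap (f i) Real.measurableSpace) _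
        (f (Fin.last k)) := by
      refine (comap_measurable (f (Fin.last k))).mono ?_ le_rfl
      simp
    have h3 : f (Fin.last k) = fun ω => X (t N) ω - X (t k) ω := by
      ext ω; simp [hf, ht']
    rw [h3] at h2
    exact h2 (measurableSet_le measurable_norm measurable_const : MeasurableSet {y : ℝ | |y| ≤ a})

lemma aux_ott {Ω : Type*} [MeasurableSpace Ω] {μ : Measure Ω} [IsProbabilityMeasure μ]
    (X : ℝ → Ω → ℝ) (hmeas : ∀ t : ℝ, Measurable (X t))
    (hstat : ∀ s t : ℝ, 0 ≤ s → s ≤ t →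
      Measure.map (fun ω => X t ω - X s ω) μ = Measure.map (X (t - s)) μ)
    (hincr : ∀ (n : ℕ) (t : Fin (n + 1) → ℝ), (∀ i, 0 ≤ t i) → StrictMono t →
      iIndepFun
        (fun i : Fin n => fun ω => X (t i.succ) ω - X (t i.castSucc) ω) μ)
    (t : ℕ → ℝ) (ht : StrictMono t) (ht0 : t 0 = 0) (N : ℕ) (a : ℝ) (ha : 0 ≤ a)
    (hhalf : ∀ r ∈ Icc 0 (t N), μ {ω | a < |X r ω|} ≤ 1 / 2) :
    μ {ω | ∃ k ≤ N, 2 * a < |X (t k) ω - X 0 ω|} ≤ 2 * μ {ω | a < |X (t N) ω|} := by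
  have hnn : ∀ j, 0 ≤ t j := fun j => ht0 ▸ ht.monotone (Nat.zero_le j)
  have hset : MeasurableSet {y : ℝ | a < |y|} := measurableSet_lt measurable_const measurable_norm
  have htr : ∀ s r, 0 ≤ s → s ≤ r → μ {ω | a < |X r ω - X s ω|} = μ {ω | a < |X (r - s) ω|} := by
    intro s r hs hr
    have := congrArg (fun ν => ν {y : ℝ | a < |y|}) (hstat s r hs hr)
    rwa [Measure.map_apply (f := fun ω => X r ω - X s ω) ((hmeas r).sub (hmeas s)) hset, Measure.map_apply (hmeas _) hset] at this
  set A : ℕ → Set Ω := fun k =>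
    {ω | (∀ j < k, |X (t j) ω - X 0 ω| ≤ 2 * a) ∧ 2 * a < |X (t k) ω - X 0 ω|} with hA
  set B : Set Ω := {ω | a < |X (t N) ω - X 0 ω|} with hB
  have hBe : μ B = μ {ω | a < |X (t N) ω|} := by
    have := htr 0 (t N) le_rfl (hnn N)
    rwa [sub_zero] at this
  have hBm : MeasurableSet B :=
    measurableSet_lt measurable_const (measurable_norm.comp ((hmeas _).sub (hmeas _)))
  have hAm : ∀ k, MeasurableSet (A k) := fun k =>
    aux_measA (fun j ω => X (t j) ω - X 0 ω) (2 * a) k fun j _ => (hmeas _).sub (hmeas _)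
  have hAd : Pairwise (Function.onFun Disjoint A) := by
    have : ∀ i j, i < j → Disjoint (A i) (A j) := by
      intro i j hij
      rw [Set.disjoint_left]
      rintro ω ⟨_, h1⟩ ⟨h2, _⟩
      exact absurd (h2 i hij) (not_le.2 h1)
    intro i j hij
    rcases hij.lt_or_gt with h | h
    · exact this i j h
    · exact (this j i h).symm
  have hstep : ∀ k ∈ Finset.range (N + 1), μ (A k) ≤ 2 * μ (A k ∩ B) := by
    intro k hk
    rw [Finset.mem_range] at hk
    rcases (Nat.lt_succ_iff.1 hk).eq_or_lt with h | h
    · subst h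
      have : A k ∩ B = A k := inter_eq_left.2 (by
        rintro ω ⟨_, h1⟩
        change a < _
        linarith)
      rw [this, two_mul]; exact le_self_add
    · have hi := aux_indep X hmeas hincr t ht ht0 N k h a (2 * a)
      set C : Set Ω := {ω | |X (t N) ω - X (t k) ω| ≤ a} with hC
      have hCm : MeasurableSet C :=
        measurableSet_le (measurable_norm.comp ((hmeas _).sub (hmeas _))) measurable_const
      have hCc : μ Cᶜ ≤ 1 / 2 := by
        have e : Cᶜ = {ω | a < |X (t N) ω - X (t k) ω|} := by ext; simp [hC]
        rw [e, htr _ _ (hnn k) (ht.monotone h.le)]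
        exact hhalf _ ⟨by linarith [ht.monotone h.le], by linarith [hnn k]⟩
      have hC2 : 1 / 2 ≤ μ C := by
        have := prob_add_prob_compl (μ := μ) hCm
        by_contra hlt
        push Not at hlt
        have h3 : μ C + μ Cᶜ < 1 / 2 + 1 / 2 :=
          ENNReal.add_lt_add_of_lt_of_le (measure_ne_top _ _) hlt hCc
        rw [this, ENNReal.add_halves] at h3
        exact lt_irrefl _ h3
      have hsub : A k ∩ C ⊆ A k ∩ B := by
        rintro ω ⟨h1, h2⟩
        refine ⟨h1, ?_⟩
        have h3 := h1.2
        change a < |X (t N) ω - X 0 ω|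
        change |X (t N) ω - X (t k) ω| ≤ a at h2
        have h4 := abs_sub_abs_le_abs_sub (X (t k) ω - X 0 ω) (X (t N) ω - X 0 ω)
        have h5 : |X (t k) ω - X 0 ω - (X (t N) ω - X 0 ω)| = |X (t N) ω - X (t k) ω| := by
          rw [abs_sub_comm]; congr 1; ring
        linarith
      calc μ (A k) = 2 * (μ (A k) * (1 / 2)) := by
            rw [mul_comm (μ (A k)), ← mul_assoc, one_div, ENNReal.mul_inv_cancel (by simp) (by simp), one_mul]
        _ ≤ 2 * (μ (A k) * μ C) := by gcongr
        _ = 2 * μ (A k ∩ C) := by rw [hi]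
        _ ≤ 2 * μ (A k ∩ B) := by gcongr
  have hcov : {ω | ∃ k ≤ N, 2 * a < |X (t k) ω - X 0 ω|} ⊆ ⋃ k ∈ Finset.range (N + 1), A k := by
    rintro ω hω
    classical
    change ∃ k, k ≤ N ∧ _ at hω
    obtain ⟨h1, h2⟩ := Nat.find_spec hω
    simp only [mem_iUnion]
    refine ⟨Nat.find hω, Finset.mem_range.2 (by omega), ?_, h2⟩
    intro j hj
    have := Nat.find_min hω hj
    push Not at this
    exact this (by omega)
  calc _ ≤ μ (⋃ k ∈ Finset.range (N + 1), A k) := measure_mono hcov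
    _ ≤ ∑ k ∈ Finset.range (N + 1), μ (A k) := measure_biUnion_finset_le _ _
    _ ≤ ∑ k ∈ Finset.range (N + 1), 2 * μ (A k ∩ B) := Finset.sum_le_sum hstep
    _ = 2 * μ (⋃ k ∈ Finset.range (N + 1), (A k ∩ B)) := by
        rw [← Finset.mul_sum, measure_biUnion_finset]
        · intro i _ j _ hij
          exact (hAd hij).mono inter_subset_left inter_subset_left
        · exact fun k _ => (hAm k).inter hBm
    _ ≤ 2 * μ B := by
        gcongr
        simp
    _ = _ := by rw [hBe]

lemma aux_sup {Ω : Type*} [MeasurableSpace Ω] {μ : Measure Ω} [IsProbabilityMeasure μ]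
    (X : ℝ → Ω → ℝ) (hmeas : ∀ t : ℝ, Measurable (X t))
    (hX0 : ∀ᵐ ω ∂μ, X 0 ω = 0)
    (hpath : ∀ᵐ ω ∂μ, ∀ t : ℝ, 0 ≤ t → ContinuousWithinAt (fun s => X s ω) (Set.Ici t) t)
    (hstat : ∀ s t : ℝ, 0 ≤ s → s ≤ t →
      Measure.map (fun ω => X t ω - X s ω) μ = Measure.map (X (t - s)) μ)
    (hincr : ∀ (n : ℕ) (t : Fin (n + 1) → ℝ), (∀ i, 0 ≤ t i) → StrictMono t →
      iIndepFun
        (fun i : Fin n => fun ω => X (t i.succ) ω - X (t i.castSucc) ω) μ)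
    (u a : ℝ) (hu : 0 < u) (ha : 0 ≤ a)
    (hhalf : ∀ r ∈ Icc 0 u, μ {ω | a < |X r ω|} ≤ 1 / 2) :
    μ {ω | ∃ s ∈ Icc 0 u, 2 * a < |X s ω|} ≤ 2 * μ {ω | a < |X u ω|} := by
  set E : ℕ → Set Ω := fun m => {ω | ∃ k : ℕ, k ≤ 2 ^ m ∧ 2 * a < |X (k * (u / 2 ^ m)) ω - X 0 ω|} with hE
  have hEb : ∀ m, μ (E m) ≤ 2 * μ {ω | a < |X u ω|} := by
    intro m
    have hq : 0 < u / 2 ^ m := by positivity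
    have hN : ((2 ^ m : ℕ) : ℝ) * (u / 2 ^ m) = u := by
      push_cast; field_simp
    have := aux_ott X hmeas hstat hincr (fun k : ℕ => k * (u / 2 ^ m))
      (fun i j hij => by
        have : (i : ℝ) < j := by exact_mod_cast hij
        exact mul_lt_mul_of_pos_right this hq) (by simp) (2 ^ m) a ha (by rw [hN]; exact hhalf)
    rwa [hN] at this
  have hEm : Monotone E := by
    apply monotone_nat_of_le_succ
    rintro m ω ⟨k, hk, h⟩
    refine ⟨2 * k, by rw [pow_succ]; omega, ?_⟩
    have : ((2 * k : ℕ) : ℝ) * (u / 2 ^ (m + 1)) = k * (u / 2 ^ m) := by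
      push_cast; rw [pow_succ]; field_simp
    rwa [this]
  calc _ ≤ μ (⋃ m, E m) := by
        apply measure_mono_ae
        filter_upwards [hX0, hpath] with ω h0 hp
        rintro ⟨s, hs, h⟩
        obtain ⟨m, k, hk, h2⟩ := aux_grid (fun s => X s ω) u s (2 * a) hu hs (hp s hs.1) h
        exact mem_iUnion.2 ⟨m, k, hk, by rw [h0, sub_zero]; exact h2⟩
    _ = ⨆ m, μ (E m) := hEm.measure_iUnion
    _ ≤ _ := iSup_le hEb

lemma aux_tight {Ω : Type*} [MeasurableSpace Ω] {μ : Measure Ω} [IsProbabilityMeasure μ]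
    (X : ℝ → Ω → ℝ) (hmeas : ∀ t : ℝ, Measurable (X t)) (T : ℝ)
    (hb : ∀ᵐ ω ∂μ, ∃ C, ∀ s ∈ Icc (0:ℝ) T, |X s ω| ≤ C) (η : ENNReal) (hη : 0 < η) :
    ∃ n : ℕ, ∀ f ∈ Icc 0 T, μ {ω | (n : ℝ) < |X f ω|} ≤ η := by
  by_contra! hcon
  choose f hf hlt using hcon
  have h1 : TendstoInMeasure μ (fun n ω => X (f n) ω / n) atTop (fun _ => (0:ℝ)) := by
    apply tendstoInMeasure_of_tendsto_ae
    · exact fun n => ((hmeas _).div_const _).aestronglyMeasurable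
    · filter_upwards [hb] with ω ⟨C, hC⟩
      refine squeeze_zero_norm (fun n => ?_) (tendsto_const_div_atTop_nhds_zero_nat C)
      rw [norm_div, Real.norm_eq_abs, Real.norm_natCast]
      exact div_le_div_of_nonneg_right (hC _ (hf n)) (Nat.cast_nonneg n)
  rw [tendstoInMeasure_iff_norm] at h1
  have h2 := (ENNReal.tendsto_nhds_zero.1 (h1 1 one_pos)) η hη
  obtain ⟨n, hn, hn1⟩ := (h2.and (eventually_ge_atTop 1)).exists
  refine absurd (hlt n) (not_lt.2 (le_trans (measure_mono ?_) hn))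
  intro ω hω
  change (n : ℝ) < _ at hω
  change 1 ≤ ‖X (f n) ω / n - 0‖
  have : (0:ℝ) < n := by exact_mod_cast hn1
  rw [sub_zero, norm_div, Real.norm_eq_abs, Real.norm_natCast, le_div_iff₀ this]
  linarith

lemma aux_wlln {Ω : Type*} [MeasurableSpace Ω] {μ : Measure Ω} [IsProbabilityMeasure μ]
    (X : ℝ → Ω → ℝ) (hmeas : ∀ t : ℝ, Measurable (X t))
    (hX0 : ∀ᵐ ω ∂μ, X 0 ω = 0)
    (hstat : ∀ s t : ℝ, 0 ≤ s → s ≤ t →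
      Measure.map (fun ω => X t ω - X s ω) μ = Measure.map (X (t - s)) μ)
    (hincr : ∀ (n : ℕ) (t : Fin (n + 1) → ℝ), (∀ i, 0 ≤ t i) → StrictMono t →
      iIndepFun
        (fun i : Fin n => fun ω => X (t i.succ) ω - X (t i.castSucc) ω) μ)
    (hint : Integrable (X 1) μ) (hmean : ∫ ω, X 1 ω ∂μ = 0) (c : ℝ) (hc : 0 < c)
    (η : ENNReal) (hη : 0 < η) :
    ∃ K : ℕ, ∀ k ≥ K, μ {ω | c * k < |X (k : ℝ) ω|} ≤ η := by
  set ξ : ℕ → Ω → ℝ := fun i ω => X ((i + 1 : ℕ) : ℝ) ω - X (i : ℝ) ω with hξ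
  have hξm : ∀ i, Measurable (ξ i) := fun i => (hmeas _).sub (hmeas _)
  have hlaw : ∀ i, IdentDistrib (ξ i) (X 1) μ μ := by
    intro i
    refine ⟨(hξm i).aemeasurable, (hmeas 1).aemeasurable, ?_⟩
    have := hstat (i : ℝ) ((i + 1 : ℕ) : ℝ) (Nat.cast_nonneg i) (by push_cast; linarith)
    rw [show (((i + 1 : ℕ) : ℝ) - i) = 1 by push_cast; ring] at this
    exact this
  have hind : Pairwise (Function.onFun (fun f g => IndepFun f g μ) ξ) := by
    intro i j hij
    have h := hincr (i + j + 1) (fun k => ((k : ℕ) : ℝ)) (fun k => Nat.cast_nonneg _)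
      (fun a b hab => Nat.cast_lt.2 (Fin.lt_def.1 hab))
    have h2 := h.indepFun (i := ⟨i, by omega⟩) (j := ⟨j, by omega⟩) (by simpa using hij)
    simpa [hξ, Function.onFun] using h2
  have hsl := strong_law_ae_real ξ ((hlaw 0).integrable_iff.2 hint) hind
    (fun i => (hlaw i).trans (hlaw 0).symm)
  rw [(hlaw 0).integral_eq, hmean] at hsl
  have h1 : TendstoInMeasure μ (fun (n : ℕ) ω => X (n : ℝ) ω / n) atTop (fun _ => (0:ℝ)) := by
    apply tendstoInMeasure_of_tendsto_ae
    · exact fun n => ((hmeas _).div_const _).aestronglyMeasurable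
    · filter_upwards [hsl, hX0] with ω h h0
      refine h.congr fun n => ?_
      have := Finset.sum_range_sub (fun i : ℕ => X (i : ℝ) ω) n
      simp only [hξ]
      rw [this]
      simp [h0]
  rw [tendstoInMeasure_iff_norm] at h1
  have h2 := (ENNReal.tendsto_nhds_zero.1 (h1 c hc)) η hη
  obtain ⟨K, hK⟩ := eventually_atTop.1 (h2.and (eventually_ge_atTop 1))
  refine ⟨K, fun k hk => le_trans (measure_mono ?_) (hK k hk).1⟩
  intro ω hω
  change c * k < _ at hω
  change c ≤ ‖X (k : ℝ) ω / k - 0‖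
  have : (0:ℝ) < k := by exact_mod_cast (hK k hk).2
  rw [sub_zero, norm_div, Real.norm_eq_abs, Real.norm_natCast, le_div_iff₀ this]
  exact hω.le

lemma aux_unif {Ω : Type*} [MeasurableSpace Ω] {μ : Measure Ω} [IsProbabilityMeasure μ]
    (X : ℝ → Ω → ℝ) (hmeas : ∀ t : ℝ, Measurable (X t))
    (hX0 : ∀ᵐ ω ∂μ, X 0 ω = 0)
    (hb : ∀ᵐ ω ∂μ, ∀ T : ℝ, ∃ C, ∀ s ∈ Icc (0:ℝ) T, |X s ω| ≤ C)
    (hstat : ∀ s t : ℝ, 0 ≤ s → s ≤ t →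
      Measure.map (fun ω => X t ω - X s ω) μ = Measure.map (X (t - s)) μ)
    (hincr : ∀ (n : ℕ) (t : Fin (n + 1) → ℝ), (∀ i, 0 ≤ t i) → StrictMono t →
      iIndepFun
        (fun i : Fin n => fun ω => X (t i.succ) ω - X (t i.castSucc) ω) μ)
    (hint : Integrable (X 1) μ) (hmean : ∫ ω, X 1 ω ∂μ = 0) (δ : ℝ) (hδ : 0 < δ)
    (η : ENNReal) (hη : 0 < η) :
    ∃ U : ℝ, ∀ u ≥ U, ∀ r ∈ Icc 0 u, μ {ω | δ * u < |X r ω|} ≤ η := by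
  have hη2 : 0 < η / 2 := ENNReal.half_pos hη.ne'
  obtain ⟨K, hK⟩ := aux_wlln X hmeas hX0 hstat hincr hint hmean (δ / 2) (half_pos hδ) _ hη2
  obtain ⟨n, hn⟩ := aux_tight X hmeas (K + 1) (hb.mono fun ω h => h _) _ hη2
  refine ⟨2 * n / δ, fun u hu r hr => ?_⟩
  have hnu : (n : ℝ) ≤ δ / 2 * u := by
    rw [ge_iff_le, div_le_iff₀ hδ] at hu; linarith
  set k := ⌊r⌋₊ with hk
  have hkr : (k : ℝ) ≤ r := Nat.floor_le hr.1
  have hkr2 : r < k + 1 := Nat.lt_floor_add_one r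
  have hset : MeasurableSet {y : ℝ | δ / 2 * u < |y|} :=
    measurableSet_lt measurable_const measurable_norm
  have htr : μ {ω | δ / 2 * u < |X r ω - X k ω|} = μ {ω | δ / 2 * u < |X (r - k) ω|} := by
    have := congrArg (fun ν => ν {y : ℝ | δ / 2 * u < |y|}) (hstat k r (Nat.cast_nonneg k) hkr)
    rwa [Measure.map_apply (f := fun ω => X r ω - X k ω) ((hmeas r).sub (hmeas k)) hset, Measure.map_apply (hmeas _) hset] at this
  have hsmall : ∀ f ∈ Icc (0:ℝ) (K + 1), μ {ω | δ / 2 * u < |X f ω|} ≤ η / 2 := fun f hf =>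
    (measure_mono fun ω (hω : δ / 2 * u < |X f ω|) => lt_of_le_of_lt hnu hω).trans (hn f hf)
  have hK0 : (0:ℝ) ≤ K := Nat.cast_nonneg K
  have h1 : μ {ω | δ / 2 * u < |X (k : ℝ) ω|} ≤ η / 2 := by
    rcases le_total K k with h | h
    · refine (measure_mono fun ω (hω : δ / 2 * u < |X (k : ℝ) ω|) => ?_).trans (hK k h)
      have : δ / 2 * k ≤ δ / 2 * u :=
        mul_le_mul_of_nonneg_left (hkr.trans hr.2) (half_pos hδ).le
      exact lt_of_le_of_lt this hω
    · have : (k : ℝ) ≤ K := by exact_mod_cast h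
      exact hsmall _ ⟨Nat.cast_nonneg k, by linarith⟩
  have h2 : μ {ω | δ / 2 * u < |X r ω - X k ω|} ≤ η / 2 := by
    rw [htr]
    exact hsmall _ ⟨by linarith, by linarith⟩
  calc μ {ω | δ * u < |X r ω|}
      ≤ μ ({ω | δ / 2 * u < |X (k : ℝ) ω|} ∪ {ω | δ / 2 * u < |X r ω - X k ω|}) := by
        apply measure_mono
        intro ω hω
        change δ * u < |X r ω| at hω
        by_contra hcon
        simp only [mem_union, mem_ofPred_eq, not_or, not_lt] at hcon
        have := abs_add_le (X (k : ℝ) ω) (X r ω - X k ω)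
        rw [add_sub_cancel] at this
        linarith [hcon.1, hcon.2]
    _ ≤ η / 2 + η / 2 := (measure_union_le _ _).trans (add_le_add h1 h2)
    _ = η := ENNReal.add_halves η

/-- **Proposition 3.2**: `Y̲(u)/u → -1` in probability as `u → ∞`. -/
theorem inf_levy_drift_lln_in_probability
    {Ω : Type*} [MeasureSpace Ω] [IsProbabilityMeasure (ℙ : Measure Ω)]
    (X : ℝ → Ω → ℝ)
    (hmeas : ∀ t : ℝ, Measurable (X t))
    (hX0 : ∀ᵐ ω ∂ℙ, X 0 ω = 0)
    (hpath : ∀ᵐ ω ∂ℙ, ∀ t : ℝ, 0 ≤ t →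
      ContinuousWithinAt (fun s => X s ω) (Set.Ici t) t ∧
      (0 < t → ∃ l : ℝ, Tendsto (fun s => X s ω) (nhdsWithin t (Set.Iio t)) (nhds l)))
    (hstat : ∀ s t : ℝ, 0 ≤ s → s ≤ t →
      Measure.map (fun ω => X t ω - X s ω) ℙ = Measure.map (X (t - s)) ℙ)
    (hincr : ∀ (n : ℕ) (t : Fin (n + 1) → ℝ), (∀ i, 0 ≤ t i) → StrictMono t →
      iIndepFun
        (fun i : Fin n => fun ω => X (t i.succ) ω - X (t i.castSucc) ω) ℙ)
    (hint : Integrable (X 1) ℙ)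
    (hmean : ∫ ω, X 1 ω ∂ℙ = 0)
    (ε : ℝ) (hε : 0 < ε) :
    Tendsto (fun u : ℝ =>
        ℙ {ω | ε < |(⨅ s : Set.Icc (0:ℝ) u, (X (s : ℝ) ω - (s : ℝ))) / u + 1|})
      atTop (nhds 0) := by
  rw [ENNReal.tendsto_nhds_zero]
  intro η hη
  have hb : ∀ᵐ ω ∂(ℙ : Measure Ω), ∀ T : ℝ, ∃ C, ∀ s ∈ Icc (0:ℝ) T, |X s ω| ≤ C := by
    filter_upwards [hpath] with ω h T
    exact aux_path_bdd (fun s => X s ω) h T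
  have hη' : 0 < min (η / 2) (1 / 2) := lt_min (ENNReal.half_pos hη.ne') (by simp)
  obtain ⟨U, hU⟩ := aux_unif X hmeas hX0 hb hstat hincr hint hmean (ε / 2) (half_pos hε) _ hη'
  filter_upwards [eventually_ge_atTop U, eventually_gt_atTop 0] with u hu hu0
  have h1 := aux_sup X hmeas hX0 (hpath.mono fun ω h t ht => (h t ht).1) hstat hincr u
    (ε / 2 * u) hu0 (by positivity) (fun r hr => (hU u hu r hr).trans (min_le_right _ _))
  calc _ ≤ ℙ {ω | ∃ s ∈ Icc 0 u, 2 * (ε / 2 * u) < |X s ω|} := by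
        apply measure_mono
        intro ω hω
        by_contra hcon
        simp only [mem_ofPred_eq] at hcon hω
        push Not at hcon
        have hle : ∀ s : Icc (0:ℝ) u, -(ε * u) - u ≤ X (s : ℝ) ω - s := by
          intro s
          have e1 := (abs_le.1 (hcon s s.2)).1
          have e2 := s.2.2
          linarith
        have hu' : u ∈ Icc (0:ℝ) u := ⟨hu0.le, le_rfl⟩
        have : Nonempty (Icc (0:ℝ) u) := ⟨⟨u, hu'⟩⟩
        have hlow := le_ciInf hle
        have hup : (⨅ s : Icc (0:ℝ) u, (X (s : ℝ) ω - (s : ℝ))) ≤ X u ω - u :=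
          ciInf_le ⟨_, by rintro _ ⟨s, rfl⟩; exact hle s⟩ (⟨u, hu'⟩ : Icc (0:ℝ) u)
        have e3 := (abs_le.1 (hcon u hu')).2
        refine absurd hω (not_lt.2 (abs_le.2 ⟨?_, ?_⟩))
        · have : -ε - 1 ≤ (⨅ s : Icc (0:ℝ) u, (X (s : ℝ) ω - (s : ℝ))) / u := by
            rw [le_div_iff₀ hu0]; linarith
          linarith
        · have : (⨅ s : Icc (0:ℝ) u, (X (s : ℝ) ω - (s : ℝ))) / u ≤ ε - 1 := by
            rw [div_le_iff₀ hu0]; linarith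
          linarith
    _ ≤ 2 * ℙ {ω | ε / 2 * u < |X u ω|} := h1
    _ ≤ 2 * (η / 2) := by
        gcongr
        exact (hU u hu u ⟨hu0.le, le_rfl⟩).trans (min_le_left _ _)
    _ = η := ENNReal.mul_div_cancel (by simp) (by simp)
end

section
/- Suppose X satisfies Assumption 1. Let f : ℕ → ℝ satisfy f(n) ≥ n for all n. Then P(X(n) > f(n)) / (n · P(X(1) > f(n))) → 1 as n → ∞ (n ranging over the positive integers). -/
open MeasureTheory ProbabilityTheory Filter Set

lemma potter_upper (g : ℝ → ℝ) (hanti : Antitone g) (hpos : ∀ x, 0 < g x) (a γ : ℝ) (hγ : 0 < γ)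
    (hga : γ < a) (h2 : Tendsto (fun x => g (2 * x) / g x) atTop (nhds ((2:ℝ) ^ (-a)))) :
    ∃ C : ℝ, 0 < C ∧ ∃ x0 : ℝ, 0 < x0 ∧ ∀ y, x0 ≤ y → g y ≤ C * y ^ (-γ) := by
  have hlt : (2:ℝ) ^ (-a) < (2:ℝ) ^ (-γ) :=
    Real.rpow_lt_rpow_of_exponent_lt (by norm_num) (by linarith)
  obtain ⟨x0, h⟩ := eventually_atTop.1 ((h2.eventually_lt_const hlt).and (eventually_gt_atTop 0))
  have hx0 : 0 < x0 := (h x0 le_rfl).2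
  refine ⟨g x0 * (2 * x0) ^ γ, mul_pos (hpos _) (by positivity), x0, hx0, ?_⟩
  have key : ∀ k : ℕ, ∀ y, x0 ≤ y → y ≤ 2 ^ (k+1) * x0 → g y ≤ g x0 * (2 * x0) ^ γ * y ^ (-γ) := by
    intro k
    induction k with
    | zero =>
      intro y h1 h2
      have hy : 0 < y := by linarith
      have : (1:ℝ) ≤ (2 * x0) ^ γ * y ^ (-γ) := by
        rw [Real.rpow_neg hy.le, ← div_eq_mul_inv, le_div_iff₀ (by positivity), one_mul]
        exact Real.rpow_le_rpow hy.le (by simpa using h2) hγ.le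
      have h3 := hanti h1
      have h4 := hpos x0
      nlinarith
    | succ k ih =>
      intro y h1 h2
      by_cases hy2 : y ≤ 2 * x0
      · refine ih y h1 (hy2.trans ?_)
        gcongr
        calc (2:ℝ) = 2^1 := by norm_num
          _ ≤ 2^(k+1) := by gcongr <;> norm_num
      · push Not at hy2
        have hy : 0 < y := by linarith
        have h5 := ih (y/2) (by linarith) (by rw [pow_succ] at h2; linarith)
        have h6 := (h (y/2) (by linarith)).1
        rw [div_lt_iff₀ (hpos _), show 2 * (y/2) = y by ring] at h6
        have : y ^ (-γ) = 2 ^ (-γ) * (y/2) ^ (-γ) := by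
          rw [← Real.mul_rpow (by norm_num) (by positivity)]; congr 1; ring
        rw [this]
        have h7 : (0:ℝ) < 2 ^ (-γ) := by positivity
        nlinarith
  intro y hy
  obtain ⟨k, hk⟩ := pow_unbounded_of_one_lt (y / x0) (by norm_num : (1:ℝ) < 2)
  refine key k y hy ?_
  rw [div_lt_iff₀ hx0] at hk
  rw [pow_succ]
  nlinarith [show (0:ℝ) < 2^k * x0 by positivity]

lemma potter_lower (g : ℝ → ℝ) (hanti : Antitone g) (hpos : ∀ x, 0 < g x) (a γ : ℝ) (hγ : 0 < γ)
    (hga : a < γ) (h2 : Tendsto (fun x => g (2 * x) / g x) atTop (nhds ((2:ℝ) ^ (-a)))) :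
    ∃ C : ℝ, 0 < C ∧ ∃ x0 : ℝ, 0 < x0 ∧ ∀ y, x0 ≤ y → C * y ^ (-γ) ≤ g y := by
  have hlt : (2:ℝ) ^ (-γ) < (2:ℝ) ^ (-a) :=
    Real.rpow_lt_rpow_of_exponent_lt (by norm_num) (by linarith)
  obtain ⟨x0, h⟩ := eventually_atTop.1 ((h2.eventually_const_lt hlt).and (eventually_gt_atTop 0))
  have hx0 : 0 < x0 := (h x0 le_rfl).2
  refine ⟨g (2*x0) * x0 ^ γ, mul_pos (hpos _) (by positivity), x0, hx0, ?_⟩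
  have key : ∀ k : ℕ, ∀ y, x0 ≤ y → y ≤ 2 ^ (k+1) * x0 → g (2*x0) * x0 ^ γ * y ^ (-γ) ≤ g y := by
    intro k
    induction k with
    | zero =>
      intro y h1 h2
      have hy : 0 < y := by linarith
      have : x0 ^ γ * y ^ (-γ) ≤ 1 := by
        rw [Real.rpow_neg hy.le, ← div_eq_mul_inv, div_le_iff₀ (by positivity), one_mul]
        exact Real.rpow_le_rpow hx0.le h1 hγ.le
      have h3 := hanti (show y ≤ 2 * x0 by simpa using h2)
      have h4 := hpos (2*x0)
      nlinarith
    | succ k ih =>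
      intro y h1 h2
      by_cases hy2 : y ≤ 2 * x0
      · refine ih y h1 (hy2.trans ?_)
        gcongr
        calc (2:ℝ) = 2^1 := by norm_num
          _ ≤ 2^(k+1) := by gcongr <;> norm_num
      · push Not at hy2
        have hy : 0 < y := by linarith
        have h5 := ih (y/2) (by linarith) (by rw [pow_succ] at h2; linarith)
        have h6 := (h (y/2) (by linarith)).1
        rw [lt_div_iff₀ (hpos _), show 2 * (y/2) = y by ring] at h6
        have : y ^ (-γ) = 2 ^ (-γ) * (y/2) ^ (-γ) := by
          rw [← Real.mul_rpow (by norm_num) (by positivity)]; congr 1; ring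
        rw [this]
        have h7 : (0:ℝ) < 2 ^ (-γ) := by positivity
        nlinarith
  intro y hy
  obtain ⟨k, hk⟩ := pow_unbounded_of_one_lt (y / x0) (by norm_num : (1:ℝ) < 2)
  refine key k y hy ?_
  rw [div_lt_iff₀ hx0] at hk
  rw [pow_succ]
  nlinarith [show (0:ℝ) < 2^k * x0 by positivity]

lemma trunc_moment {Ω : Type*} [MeasurableSpace Ω] (P : Measure Ω) (Z : Ω → ℝ)
    (hZ : Integrable Z P) :
    Tendsto (fun s : ℝ => ∫ ω, min |Z ω| (s * Z ω ^ 2) ∂P) (nhdsWithin 0 (Ioi 0)) (nhds 0) := by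
  have : Tendsto (fun s : ℝ => ∫ ω, min |Z ω| (s * Z ω ^ 2) ∂P) (nhdsWithin 0 (Ioi 0))
      (nhds (∫ ω, (0:ℝ) ∂P)) := by
    refine tendsto_integral_filter_of_dominated_convergence (fun ω => |Z ω|) ?_ ?_ hZ.abs ?_
    · filter_upwards with s
      exact hZ.1.norm.inf ((hZ.1.pow 2).const_mul s)
    · filter_upwards [self_mem_nhdsWithin] with s hs
      filter_upwards with ω
      have hs' : 0 < s := hs
      rw [Real.norm_eq_abs, abs_of_nonneg (le_min (abs_nonneg _) (by positivity))]
      exact min_le_left _ _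
    · filter_upwards with ω
      have : Tendsto (fun s : ℝ => min |Z ω| (s * Z ω ^ 2)) (nhds 0) (nhds (min |Z ω| (0 * Z ω ^ 2))) := by
        apply Continuous.tendsto; fun_prop
      simp only [zero_mul, abs_nonneg, inf_of_le_right] at this
      exact this.mono_left nhdsWithin_le_nhds
  simpa using this

lemma exp_pointwise (s M z : ℝ) (hs : 0 < s) (hM : 1 / s ≤ M) :
    Real.exp (s * min z M) ≤ 1 + s * z + s * min |z| (s * z ^ 2)
      + (if 1 / s < z then Real.exp (s * M) else 0) := by
  have hmin : 0 ≤ min |z| (s * z ^ 2) := le_min (abs_nonneg _) (by positivity)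
  split_ifs with h
  · have h1 : Real.exp (s * min z M) ≤ Real.exp (s * M) := by
      gcongr; exact min_le_right _ _
    have : 0 < z := lt_trans (by positivity) h
    nlinarith [mul_pos hs this, mul_nonneg hs.le hmin]
  · push Not at h
    rw [min_eq_left (h.trans hM)]
    have h1 : s * z ≤ 1 := by rwa [le_div_iff₀ hs, mul_comm] at h
    have h2 : s * min |z| (s * z ^ 2) = min |s * z| ((s*z)^2) := by
      rw [mul_min_of_nonneg _ _ hs.le, abs_mul, abs_of_pos hs]; congr 1; ring
    rw [h2]
    generalize s * z = u at h1
    rw [add_zero]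
    by_cases hu : -1 ≤ u
    · have h3 := Real.abs_exp_sub_one_sub_id_le (abs_le.2 ⟨hu, h1⟩)
      have h4 := (abs_le.1 h3).2
      have : u^2 ≤ |u| := by
        have := abs_le.2 ⟨hu, h1⟩
        rw [← sq_abs]; nlinarith [abs_nonneg u]
      rw [min_eq_right this]; linarith
    · push Not at hu
      have : |u| ≤ u^2 := by
        rw [abs_of_neg (by linarith)]; nlinarith
      rw [min_eq_left this, abs_of_neg (by linarith)]
      have : Real.exp u ≤ 1 := Real.exp_le_one_iff.2 (by linarith)
      linarith

lemma mgf_trunc_le {Ω : Type*} [MeasurableSpace Ω] (P : Measure Ω) [IsProbabilityMeasure P]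
    (Z : Ω → ℝ) (hm : Measurable Z) (hZ : Integrable Z P) (h0 : ∫ ω, Z ω ∂P = 0)
    (s M : ℝ) (hs : 0 < s) (hM : 1 / s ≤ M) :
    mgf (fun ω => min (Z ω) M) P s ≤ 1 + s * (∫ ω, min |Z ω| (s * Z ω ^ 2) ∂P)
      + P.real {ω | 1 / s < Z ω} * Real.exp (s * M) := by
  have hset : MeasurableSet {ω | 1 / s < Z ω} := measurableSet_lt measurable_const hm
  have hI1 : Integrable (fun ω => min |Z ω| (s * Z ω ^ 2)) P := by
    refine hZ.abs.mono' (hZ.1.norm.inf ((hZ.1.pow 2).const_mul s)) ?_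
    filter_upwards with ω
    rw [Real.norm_eq_abs, abs_of_nonneg (le_min (abs_nonneg _) (by positivity))]
    exact min_le_left _ _
  have hI2 : Integrable ({ω | 1 / s < Z ω}.indicator (fun _ => Real.exp (s * M))) P :=
    (integrable_const _).indicator hset
  have hI3 : Integrable (fun ω => 1 + s * Z ω) P := (integrable_const _).add (hZ.const_mul s)
  have hI4 : Integrable (fun ω => 1 + s * Z ω + s * min |Z ω| (s * Z ω ^ 2)) P :=
    hI3.add (hI1.const_mul s)
  have : mgf (fun ω => min (Z ω) M) P s ≤ ∫ ω, (1 + s * Z ω + s * min |Z ω| (s * Z ω ^ 2)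
      + {ω | 1 / s < Z ω}.indicator (fun _ => Real.exp (s * M)) ω) ∂P := by
    refine integral_mono_of_nonneg ?_ (hI4.add hI2) ?_
    · filter_upwards with ω; positivity
    · filter_upwards with ω
      exact exp_pointwise s M (Z ω) hs hM
  refine this.trans (le_of_eq ?_)
  rw [integral_add hI4 hI2, integral_add hI3 (hI1.const_mul s),
    integral_add (integrable_const _) (hZ.const_mul s), integral_const_mul, integral_const_mul, h0,
    integral_indicator_const _ hset]
  simp

lemma chernoff_trunc {Ω : Type*} [MeasurableSpace Ω] (P : Measure Ω) [IsProbabilityMeasure P]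
    (ξ : ℕ → Ω → ℝ) (hm : ∀ i, Measurable (ξ i)) (hind : iIndepFun ξ P)
    (hid : ∀ i, IdentDistrib (ξ i) (ξ 0) P P)
    (hZ : Integrable (ξ 0) P) (h0 : ∫ ω, ξ 0 ω ∂P = 0)
    (s M x : ℝ) (hs : 0 < s) (hM : 1 / s ≤ M) (n : ℕ) :
    P.real {ω | (∀ i < n, ξ i ω ≤ M) ∧ x < ∑ i ∈ Finset.range n, ξ i ω} ≤
      Real.exp (-s * x + n * (s * (∫ ω, min |ξ 0 ω| (s * ξ 0 ω ^ 2) ∂P)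
        + P.real {ω | 1 / s < ξ 0 ω} * Real.exp (s * M))) := by
  set Y : ℕ → Ω → ℝ := fun i ω => min (ξ i ω) M with hY
  have hYm : ∀ i, Measurable (Y i) := fun i => (hm i).min measurable_const
  have hmm : Measurable (fun z : ℝ => min z M) := measurable_id.min measurable_const
  have hYind : iIndepFun Y P := hind.comp (fun _ z => min z M) (fun _ => hmm)
  have hYid : ∀ i, IdentDistrib (Y i) (Y 0) P P := fun i => (hid i).comp hmm
  have hSm : Measurable (fun ω => (∑ i ∈ Finset.range n, Y i) ω) := by
    simp only [Finset.sum_apply]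
    exact Finset.measurable_sum _ (fun i _ => hYm i)
  have hint : Integrable (fun ω => Real.exp (s * (∑ i ∈ Finset.range n, Y i) ω)) P := by
    refine Integrable.of_bound (C := Real.exp (s * (n * M))) (by fun_prop) ?_
    filter_upwards with ω
    rw [Real.norm_eq_abs, abs_of_pos (Real.exp_pos _)]
    gcongr
    rw [Finset.sum_apply]
    calc ∑ i ∈ Finset.range n, Y i ω ≤ ∑ i ∈ Finset.range n, M :=
          Finset.sum_le_sum (fun i _ => min_le_right _ _)
      _ = n * M := by simp
  have h1 := measure_ge_le_exp_mul_mgf (μ := P) x hs.le hint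
  have h2 : P.real {ω | (∀ i < n, ξ i ω ≤ M) ∧ x < ∑ i ∈ Finset.range n, ξ i ω} ≤
      P.real {ω | x ≤ (∑ i ∈ Finset.range n, Y i) ω} := by
    refine measureReal_mono ?_
    rintro ω ⟨ha, hb⟩
    have : (∑ i ∈ Finset.range n, Y i) ω = ∑ i ∈ Finset.range n, ξ i ω := by
      rw [Finset.sum_apply]
      exact Finset.sum_congr rfl (fun i hi => min_eq_left (ha i (Finset.mem_range.1 hi)))
    simp only [mem_ofPred_eq, this]
    exact hb.le
  refine (h2.trans h1).trans ?_
  rw [hYind.mgf_sum hYm, Finset.prod_congr rfl (fun i _ => congrFun (mgf_congr_identDistrib (hYid i)) s),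
    Finset.prod_const, Finset.card_range, Real.exp_add, Real.exp_nat_mul]
  gcongr
  · exact mgf_nonneg
  refine (mgf_trunc_le P (ξ 0) (hm 0) hZ h0 s M hs hM).trans ?_
  rw [add_assoc, add_comm (1:ℝ)]
  exact Real.add_one_le_exp _

lemma exponent_bound (g m : ℝ → ℝ) (γ β : ℝ) (hγ : 1 < γ) (hβ : 0 < β)
    (hm : Tendsto m (nhdsWithin 0 (Ioi 0)) (nhds 0)) (hg0 : ∀ x, 0 ≤ g x)
    (C x0 : ℝ) (hC : 0 < C) (hup : ∀ y, x0 ≤ y → g y ≤ C * y ^ (-γ))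
    (c x1 : ℝ) (hc : 0 < c) (hlow : ∀ y, x1 ≤ y → c * y ^ (-β) ≤ g y)
    (K η : ℝ) (hK : K = 2 * (β + 1)) (hη : η * K = (γ - 1) / 2) (ε : ℝ) (hε : 0 < ε) :
    ∀ᶠ x : ℝ in atTop, ∃ s : ℝ, 0 < s ∧ 1 / s ≤ η * x ∧ ∀ n : ℕ, (n : ℝ) ≤ x →
      Real.exp (-s * x + n * (s * m s + g (1 / s) * Real.exp (s * (η * x)))) ≤ ε * g x := by
  have hKpos : 0 < K := by rw [hK]; positivity
  have hlog0 : Tendsto (fun x : ℝ => Real.log x / x) atTop (nhds 0) := by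
    have := (Real.isLittleO_log_id_atTop).tendsto_div_nhds_zero
    simpa using this
  have hs0 : Tendsto (fun x : ℝ => K * Real.log x / x) atTop (nhdsWithin 0 (Ioi 0)) := by
    refine tendsto_nhdsWithin_iff.2 ⟨?_, ?_⟩
    · have := hlog0.const_mul K
      simpa [mul_div_assoc] using this
    · filter_upwards [eventually_gt_atTop 1] with x hx
      have := Real.log_pos hx
      have h3 : 0 < x := by linarith
      show 0 < K * Real.log x / x
      positivity
  have hinv : Tendsto (fun x : ℝ => 1 / (K * Real.log x / x)) atTop atTop := by
    have := tendsto_inv_nhdsGT_zero.comp hs0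
    simp only [one_div]
    exact this
  have hm' := (hm.comp hs0).eventually_lt_const (show (0:ℝ) < 1/2 by norm_num)
  have hsmall : Tendsto (fun x : ℝ => C * K ^ γ * (Real.log x ^ γ / x ^ ((γ-1)/2))) atTop (nhds 0) := by
    have := ((isLittleO_log_rpow_rpow_atTop γ (show 0 < (γ-1)/2 by linarith)).tendsto_div_nhds_zero).const_mul (C * K ^ γ)
    simpa using this
  have hθlog := (Real.tendsto_log_atTop.const_mul_atTop (show 0 < (γ-1)/2 by linarith)).eventually_ge_atTop 1
  filter_upwards [eventually_gt_atTop 1, hm', hinv.eventually_ge_atTop x0,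
    hsmall.eventually_lt_const one_pos, hθlog, eventually_ge_atTop x1,
    eventually_ge_atTop (Real.exp 1 / (ε * c))] with x hx h1 h2 h3 h4 h5 h6
  have hxp : 0 < x := by linarith
  have hl := Real.log_pos hx
  set s := K * Real.log x / x with hs
  have hspos : 0 < s := by positivity
  have hsx : s * x = K * Real.log x := by rw [hs]; field_simp
  refine ⟨s, hspos, ?_, fun n hn => ?_⟩
  · rw [div_le_iff₀ hspos]
    calc (1:ℝ) ≤ (γ-1)/2 * Real.log x := h4
      _ = η * K * Real.log x := by rw [hη]
      _ = η * (s * x) := by rw [hsx]; ring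
      _ = η * x * s := by ring
  have hexp : Real.exp (s * (η * x)) = x ^ ((γ-1)/2) := by
    rw [Real.rpow_def_of_pos hxp, ← hη]; congr 1
    calc s * (η * x) = η * (s * x) := by ring
      _ = _ := by rw [hsx]; ring
  have hg1 : g (1 / s) ≤ C * s ^ γ := by
    refine (hup _ h2).trans (le_of_eq ?_)
    rw [one_div, Real.inv_rpow hspos.le, Real.rpow_neg hspos.le, inv_inv]
  have hA : n * (g (1/s) * Real.exp (s * (η * x))) ≤ 1 := by
    calc n * (g (1/s) * Real.exp (s * (η * x))) ≤ x * (C * s ^ γ * x ^ ((γ-1)/2)) := by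
          rw [hexp]
          have := hg0 (1/s)
          gcongr
      _ = C * K ^ γ * (Real.log x ^ γ / x ^ ((γ-1)/2)) := by
          have e1 : s ^ γ = K ^ γ * Real.log x ^ γ / x ^ γ := by
            rw [hs, Real.div_rpow (by positivity) hxp.le, Real.mul_rpow hKpos.le hl.le]
          have e2 : x ^ γ = x * (x ^ ((γ-1)/2) * x ^ ((γ-1)/2)) := by
            rw [← Real.rpow_add hxp, ← Real.rpow_one_add' hxp.le (by linarith)]; congr 1; ring
          rw [e1, e2]
          field_simp
      _ ≤ 1 := h3.le
  have hB : n * (s * m s) ≤ K * Real.log x / 2 := by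
    rw [← hsx]
    have h1' : m s < 1/2 := h1
    have hns : n * s ≤ x * s := by gcongr
    have : 0 ≤ n * s := by positivity
    nlinarith
  have hkey : -s * x + n * (s * m s + g (1 / s) * Real.exp (s * (η * x))) ≤ 1 + Real.log x * (-β - 1) := by
    have : -s * x = - (K * Real.log x) := by rw [← hsx]; ring
    rw [this, mul_add]
    have : K * Real.log x = 2 * (β + 1) * Real.log x := by rw [hK]
    nlinarith
  calc _ ≤ Real.exp (1 + Real.log x * (-β - 1)) := Real.exp_le_exp.2 hkey
    _ = Real.exp 1 / x * x ^ (-β) := by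
        rw [Real.exp_add, ← Real.rpow_def_of_pos hxp, Real.rpow_sub_one hxp.ne']; ring
    _ ≤ (ε * c) * x ^ (-β) := by
        gcongr
        rw [div_le_iff₀ hxp]
        rwa [div_le_iff₀ (by positivity), mul_comm] at h6
    _ ≤ ε * g x := by
        rw [mul_assoc]; gcongr; exact hlow x h5

lemma wlln {Ω : Type*} [MeasurableSpace Ω] (P : Measure Ω) [IsProbabilityMeasure P]
    (ξ : ℕ → Ω → ℝ) (hm : ∀ i, Measurable (ξ i)) (hind : iIndepFun ξ P)
    (hid : ∀ i, IdentDistrib (ξ i) (ξ 0) P P)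
    (hZ : Integrable (ξ 0) P) (h0 : ∫ ω, ξ 0 ω ∂P = 0) (δ : ℝ) (hδ : 0 < δ) :
    ∃ w : ℕ → ℝ, Tendsto w atTop (nhds 0) ∧ ∀ n : ℕ, 0 < n → ∀ x : ℝ, n ≤ x → ∀ i < n,
      P.real {ω | δ * x ≤ |∑ j ∈ (Finset.range n).erase i, ξ j ω|} ≤ w n := by
  have hlaw := strong_law_ae_real ξ hZ (fun i j hij => hind.indepFun hij) hid
  rw [h0] at hlaw
  have t1 : TendstoInMeasure P (fun (n:ℕ) ω => (∑ i ∈ Finset.range n, ξ i ω) / n) atTop (fun _ => 0) :=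
    tendstoInMeasure_of_tendsto_ae (fun n => by
      have : Measurable (fun ω => (∑ i ∈ Finset.range n, ξ i ω) / (n:ℝ)) :=
        (Finset.measurable_fun_sum _ (fun i _ => hm i)).div_const _
      exact this.aestronglyMeasurable) hlaw
  have t2 : TendstoInMeasure P (fun (n:ℕ) ω => ξ 0 ω / n) atTop (fun _ => 0) :=
    tendstoInMeasure_of_tendsto_ae (fun n => ((hm 0).div_const _).aestronglyMeasurable)
      (by filter_upwards with ω; exact tendsto_const_div_atTop_nhds_zero_nat _)
  rw [tendstoInMeasure_iff_measureReal_norm] at t1 t2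
  have t1' := t1 (δ/2) (by positivity)
  have t2' := t2 (δ/2) (by positivity)
  simp only [sub_zero, Real.norm_eq_abs] at t1' t2'
  refine ⟨fun n => P.real {ω | δ/2 ≤ |(∑ i ∈ Finset.range n, ξ i ω) / (n:ℝ)|}
    + P.real {ω | δ/2 ≤ |ξ 0 ω / (n:ℝ)|}, by simpa only [add_zero] using t1'.add t2', ?_⟩
  intro n hn x hx i hi
  have hn' : (0:ℝ) < n := by exact_mod_cast hn
  have hsub : {ω | δ * x ≤ |∑ j ∈ (Finset.range n).erase i, ξ j ω|} ⊆
      {ω | δ/2 ≤ |(∑ i ∈ Finset.range n, ξ i ω) / n|} ∪ {ω | δ/2 ≤ |ξ i ω / n|} := by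
    intro ω hω
    by_contra hcon
    simp only [mem_union, mem_ofPred_eq, not_or, not_le, abs_div, Nat.abs_cast, div_lt_iff₀ hn'] at hcon hω
    have hsum := Finset.add_sum_erase (Finset.range n) (fun j => ξ j ω) (Finset.mem_range.2 hi)
    have := abs_sub (∑ i ∈ Finset.range n, ξ i ω) (ξ i ω)
    rw [← hsum, add_sub_cancel_left, hsum] at this
    have : δ * n ≤ δ * x := by gcongr
    linarith
  have heq : P.real {ω | δ/2 ≤ |ξ i ω / n|} = P.real {ω | δ/2 ≤ |ξ 0 ω / n|} := by
    have hset : MeasurableSet {z : ℝ | δ/2 ≤ |z / n|} :=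
      measurableSet_le measurable_const (by fun_prop)
    exact congrArg ENNReal.toReal ((hid i).measure_mem_eq hset)
  calc _ ≤ _ := measureReal_mono hsub
    _ ≤ _ := measureReal_union_le _ _
    _ = _ := by rw [heq]

lemma tail_eq {Ω : Type*} [MeasurableSpace Ω] (P : Measure Ω)
    (ξ : ℕ → Ω → ℝ) (hid : ∀ i, IdentDistrib (ξ i) (ξ 0) P P) (i : ℕ) (y : ℝ) :
    P.real {ω | y < ξ i ω} = P.real {ω | y < ξ 0 ω} :=
  congrArg ENNReal.toReal ((hid i).measure_mem_eq measurableSet_Ioi)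

lemma indep_real {Ω : Type*} [MeasurableSpace Ω] (P : Measure Ω) (U V : Ω → ℝ)
    (h : IndepFun U V P) (A B : Set ℝ) (hA : MeasurableSet A) (hB : MeasurableSet B) :
    P.real (U ⁻¹' A ∩ V ⁻¹' B) = P.real (U ⁻¹' A) * P.real (V ⁻¹' B) := by
  simp only [Measure.real, h.measure_inter_preimage_eq_mul A B hA hB, ENNReal.toReal_mul]

lemma upper_ineq {Ω : Type*} [MeasurableSpace Ω] (P : Measure Ω) [IsProbabilityMeasure P]
    (ξ : ℕ → Ω → ℝ) (hm : ∀ i, Measurable (ξ i)) (hind : iIndepFun ξ P)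
    (hid : ∀ i, IdentDistrib (ξ i) (ξ 0) P P) (n : ℕ) (x δ η w : ℝ)
    (hw : ∀ i < n, P.real {ω | δ * x ≤ |∑ j ∈ (Finset.range n).erase i, ξ j ω|} ≤ w) :
    P.real {ω | x < ∑ i ∈ Finset.range n, ξ i ω} ≤
      n * P.real {ω | (1 - δ) * x < ξ 0 ω} + n * (P.real {ω | η * x < ξ 0 ω} * w)
      + P.real {ω | (∀ i < n, ξ i ω ≤ η * x) ∧ x < ∑ i ∈ Finset.range n, ξ i ω} := by
  set A : ℕ → Set Ω := fun i => {ω | (1 - δ) * x < ξ i ω}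
  set B : ℕ → Set Ω := fun i => {ω | η * x < ξ i ω} ∩
    {ω | δ * x ≤ |∑ j ∈ (Finset.range n).erase i, ξ j ω|} with hBdef
  have hsub : {ω | x < ∑ i ∈ Finset.range n, ξ i ω} ⊆
      ((⋃ i ∈ Finset.range n, A i) ∪ (⋃ i ∈ Finset.range n, B i)) ∪
      {ω | (∀ i < n, ξ i ω ≤ η * x) ∧ x < ∑ i ∈ Finset.range n, ξ i ω} := by
    intro ω hω
    by_contra hcon
    simp only [mem_union, not_or, mem_iUnion, not_exists, Finset.mem_range] at hcon
    obtain ⟨⟨h1, h2⟩, h3⟩ := hcon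
    apply h3
    refine ⟨fun i hi => ?_, hω⟩
    by_contra h4
    push Not at h4
    have h5 := h1 i hi
    simp only [A, mem_ofPred_eq, not_lt] at h5
    refine h2 i hi ⟨h4, ?_⟩
    have hsum := Finset.add_sum_erase (Finset.range n) (fun j => ξ j ω) (Finset.mem_range.2 hi)
    simp only [mem_ofPred_eq] at hω ⊢
    refine le_trans ?_ (le_abs_self _)
    linarith
  have hAle : P.real (⋃ i ∈ Finset.range n, A i) ≤ n * P.real {ω | (1 - δ) * x < ξ 0 ω} := by
    refine (measureReal_biUnion_finset_le _ _).trans (le_of_eq ?_)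
    rw [Finset.sum_congr rfl (fun i _ => tail_eq P ξ hid i _)]; simp
  have hBle : P.real (⋃ i ∈ Finset.range n, B i) ≤ n * (P.real {ω | η * x < ξ 0 ω} * w) := by
    refine (measureReal_biUnion_finset_le _ _).trans ?_
    calc _ ≤ ∑ i ∈ Finset.range n, P.real {ω | η * x < ξ 0 ω} * w := by
          refine Finset.sum_le_sum (fun i hi => ?_)
          have hin := (hind.indepFun_finsetSum_of_notMem hm (Finset.notMem_erase i (Finset.range n))).symm
          have := indep_real P _ _ hin (Ioi (η * x)) {z | δ * x ≤ |z|} measurableSet_Ioi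
            (measurableSet_le measurable_const (by fun_prop))
          have e : B i = ξ i ⁻¹' (Ioi (η * x)) ∩ (∑ j ∈ (Finset.range n).erase i, ξ j) ⁻¹' {z | δ * x ≤ |z|} := by
            ext ω; simp [B]
          rw [e, this]
          have e1 : P.real (ξ i ⁻¹' (Ioi (η * x))) = P.real {ω | η * x < ξ 0 ω} := tail_eq P ξ hid i _
          have e2 : P.real ((∑ j ∈ (Finset.range n).erase i, ξ j) ⁻¹' {z | δ * x ≤ |z|}) ≤ w := by
            have := hw i (Finset.mem_range.1 hi)
            convert this using 3
            ext ω; simp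
          rw [e1]; gcongr
      _ = _ := by simp
  calc _ ≤ _ := measureReal_mono hsub
    _ ≤ _ := measureReal_union_le _ _
    _ ≤ _ := by
      gcongr
      exact (measureReal_union_le _ _).trans (add_le_add hAle hBle)

lemma lower_ineq {Ω : Type*} [MeasurableSpace Ω] (P : Measure Ω) [IsProbabilityMeasure P]
    (ξ : ℕ → Ω → ℝ) (hm : ∀ i, Measurable (ξ i)) (hind : iIndepFun ξ P)
    (hid : ∀ i, IdentDistrib (ξ i) (ξ 0) P P) (n : ℕ) (x δ w : ℝ)
    (hw : ∀ i < n, P.real {ω | δ * x ≤ |∑ j ∈ (Finset.range n).erase i, ξ j ω|} ≤ w) :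
    n * (P.real {ω | (1 + δ) * x < ξ 0 ω} * (1 - w - n * P.real {ω | (1 + δ) * x < ξ 0 ω})) ≤
    P.real {ω | x < ∑ i ∈ Finset.range n, ξ i ω} := by
  set q := P.real {ω | (1 + δ) * x < ξ 0 ω} with hq
  have hq0 : 0 ≤ q := measureReal_nonneg
  set B : ℕ → Set Ω := fun i => {ω | (1 + δ) * x < ξ i ω} with hB
  set G : ℕ → Set Ω := fun i => {ω | δ * x ≤ |∑ j ∈ (Finset.range n).erase i, ξ j ω|} with hG
  set D : ℕ → Set Ω := fun i => (B i \ G i) \ ⋃ j ∈ (Finset.range n).erase i, B j with hD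
  have hBm : ∀ i, MeasurableSet (B i) := fun i => measurableSet_lt measurable_const (hm i)
  have hRm : ∀ i, Measurable (fun ω => ∑ j ∈ (Finset.range n).erase i, ξ j ω) :=
    fun i => Finset.measurable_fun_sum _ (fun i _ => hm i)
  have hGm : ∀ i, MeasurableSet (G i) := fun i =>
    measurableSet_le measurable_const (hRm i).norm
  have hDm : ∀ i, MeasurableSet (D i) := fun i =>
    ((hBm i).diff (hGm i)).diff (Finset.measurableSet_biUnion _ (fun j _ => hBm j))
  have hBq : ∀ i, P.real (B i) = q := fun i => tail_eq P ξ hid i _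
  have hsub : (⋃ i ∈ Finset.range n, D i) ⊆ {ω | x < ∑ i ∈ Finset.range n, ξ i ω} := by
    intro ω hω
    simp only [mem_iUnion] at hω
    obtain ⟨i, hi, ⟨h1, h2⟩, h3⟩ := hω
    have hsum := Finset.add_sum_erase (Finset.range n) (fun j => ξ j ω) hi
    simp only [B, G, mem_ofPred_eq, not_le] at h1 h2 ⊢
    have := (abs_lt.1 h2).1
    linarith
  have hdisj : PairwiseDisjoint (↑(Finset.range n)) D := by
    intro i hi j hj hij
    refine Set.disjoint_left.2 ?_
    rintro ω ⟨⟨h1, h2⟩, h3⟩ ⟨h4, h5⟩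
    apply h5
    simp only [mem_iUnion]
    exact ⟨i, Finset.mem_erase.2 ⟨hij, hi⟩, h1⟩
  have hDge : ∀ i ∈ Finset.range n, q * (1 - w - n * q) ≤ P.real (D i) := by
    intro i hi
    have hin := (hind.indepFun_finsetSum_of_notMem hm (Finset.notMem_erase i (Finset.range n))).symm
    have e0 := indep_real P _ _ hin (Ioi ((1 + δ) * x)) {z | δ * x ≤ |z|} measurableSet_Ioi
      (measurableSet_le measurable_const (by fun_prop))
    have e1 : ξ i ⁻¹' (Ioi ((1 + δ) * x)) = B i := rfl
    have e2 : (∑ j ∈ (Finset.range n).erase i, ξ j) ⁻¹' {z | δ * x ≤ |z|} = G i := by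
      ext ω; simp [G]
    rw [e1, e2, hBq] at e0
    have hGw : P.real (G i) ≤ w := hw i (Finset.mem_range.1 hi)
    have hpair : P.real (⋃ j ∈ (Finset.range n).erase i, (B i ∩ B j)) ≤ n * (q * q) := by
      refine (measureReal_biUnion_finset_le _ _).trans ?_
      calc _ ≤ ∑ j ∈ (Finset.range n).erase i, q * q := by
            refine Finset.sum_le_sum (fun j hj => le_of_eq ?_)
            have hne := (Finset.mem_erase.1 hj).1
            have := indep_real P _ _ (hind.indepFun hne.symm) (Ioi ((1 + δ) * x))
              (Ioi ((1 + δ) * x)) measurableSet_Ioi measurableSet_Ioi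
            rw [e1, show ξ j ⁻¹' (Ioi ((1 + δ) * x)) = B j from rfl, hBq, hBq] at this
            exact this
        _ ≤ ∑ j ∈ Finset.range n, q * q :=
            Finset.sum_le_sum_of_subset_of_nonneg (Finset.erase_subset _ _)
              (fun _ _ _ => by positivity)
        _ = _ := by simp
    have hcov : B i ⊆ (D i ∪ (B i ∩ G i)) ∪ ⋃ j ∈ (Finset.range n).erase i, (B i ∩ B j) := by
      intro ω hω
      by_cases h1 : ω ∈ G i
      · exact Or.inl (Or.inr ⟨hω, h1⟩)
      by_cases h2 : ω ∈ ⋃ j ∈ (Finset.range n).erase i, B j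
      · right
        simp only [mem_iUnion] at h2 ⊢
        obtain ⟨j, hj, h⟩ := h2
        exact ⟨j, hj, hω, h⟩
      · exact Or.inl (Or.inl ⟨⟨hω, h1⟩, h2⟩)
    have h1 := measureReal_mono (μ := P) hcov
    have h2 := measureReal_union_le (μ := P) (D i ∪ (B i ∩ G i)) (⋃ j ∈ (Finset.range n).erase i, (B i ∩ B j))
    have h3 := measureReal_union_le (μ := P) (D i) (B i ∩ G i)
    rw [hBq] at h1
    have : q * P.real (G i) ≤ q * w := by gcongr
    nlinarith
  calc _ = ∑ i ∈ Finset.range n, q * (1 - w - n * q) := by simp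
    _ ≤ ∑ i ∈ Finset.range n, P.real (D i) := Finset.sum_le_sum hDge
    _ = P.real (⋃ i ∈ Finset.range n, D i) := (measureReal_biUnion_finset hdisj (fun i _ => hDm i)).symm
    _ ≤ _ := measureReal_mono hsub

theorem iid_main {Ω : Type*} [MeasurableSpace Ω] (P : Measure Ω) [IsProbabilityMeasure P]
    (ξ : ℕ → Ω → ℝ) (hm : ∀ i, Measurable (ξ i)) (hind : iIndepFun ξ P)
    (hid : ∀ i, IdentDistrib (ξ i) (ξ 0) P P)
    (hZ : Integrable (ξ 0) P) (h0 : ∫ ω, ξ 0 ω ∂P = 0) (α : ℝ) (hα : 1 < α)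
    (g : ℝ → ℝ) (hg : ∀ x, g x = P.real {ω | x < ξ 0 ω})
    (hpos : ∀ x, 0 < g x)
    (hRV : ∀ c : ℝ, 0 < c → Tendsto (fun x : ℝ => g (c * x) / g x) atTop (nhds (c ^ (-α))))
    (f : ℕ → ℝ) (hf : ∀ n : ℕ, (n : ℝ) ≤ f n) :
    Tendsto (fun n : ℕ => P.real {ω | f n < ∑ i ∈ Finset.range n, ξ i ω} / (n * g (f n)))
      atTop (nhds 1) := by
  have hanti : Antitone g := by
    intro x y hxy
    rw [hg, hg]
    exact measureReal_mono (fun ω h => lt_of_le_of_lt hxy h)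
  have hftop : Tendsto f atTop atTop :=
    tendsto_atTop_mono hf tendsto_natCast_atTop_atTop
  set γ := (1 + α) / 2 with hγdef
  have hγ : 1 < γ := by rw [hγdef]; linarith
  obtain ⟨C, hC, x0, hx0, hup⟩ := potter_upper g hanti hpos α γ (by linarith)
    (by rw [hγdef]; linarith) (hRV 2 (by norm_num))
  obtain ⟨c, hc, x1, hx1, hlow⟩ := potter_lower g hanti hpos α (α+1) (by linarith)
    (by linarith) (hRV 2 (by norm_num))
  have hnF : ∀ a : ℝ, 0 < a → Tendsto (fun n : ℕ => n * g (a * f n)) atTop (nhds 0) := by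
    intro a ha
    have h1 : Tendsto (fun n : ℕ => C * a ^ (-γ) * (f n) ^ (-(γ - 1))) atTop (nhds 0) := by
      simpa using ((tendsto_rpow_neg_atTop (show 0 < γ - 1 by linarith)).comp hftop).const_mul (C * a ^ (-γ))
    refine squeeze_zero' ?_ ?_ h1
    · filter_upwards with n
      have := hpos (a * f n)
      positivity
    · filter_upwards [(hftop.const_mul_atTop ha).eventually_ge_atTop x0,
        hftop.eventually_gt_atTop 0] with n h2 h3
      calc n * g (a * f n) ≤ f n * (C * (a * f n) ^ (-γ)) := by
            have := (hpos (a * f n)).le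
            have := hf n
            have := hup _ h2
            gcongr
        _ = _ := by
            rw [Real.mul_rpow ha.le h3.le, show -(γ-1) = 1 + -γ by ring,
              Real.rpow_one_add' h3.le (by linarith)]
            ring
  have hratio : ∀ a : ℝ, 0 < a → Tendsto (fun n : ℕ => g (a * f n) / g (f n)) atTop (nhds (a ^ (-α))) :=
    fun a ha => (hRV a ha).comp hftop
  have hcont : Tendsto (fun d : ℝ => (1 + d) ^ (-α)) (nhds 0) (nhds 1) := by
    have : ContinuousAt (fun d : ℝ => (1 + d) ^ (-α)) 0 := by
      refine ContinuousAt.rpow_const (by fun_prop) (Or.inl (by norm_num))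
    simpa [ContinuousAt] using this
  rw [tendsto_order]
  constructor
  · intro a ha
    obtain ⟨δ, hδa, hδ⟩ : ∃ δ : ℝ, a < (1 + δ) ^ (-α) ∧ 0 < δ :=
      (((hcont.eventually_const_lt ha).filter_mono nhdsWithin_le_nhds).and
        (self_mem_nhdsWithin : Ioi (0:ℝ) ∈ nhdsWithin 0 (Ioi 0))).exists
    obtain ⟨w, hw0, hw⟩ := wlln P ξ hm hind hid hZ h0 δ hδ
    have hlim : Tendsto (fun n : ℕ => g ((1+δ) * f n) / g (f n) * (1 - w n - n * g ((1+δ) * f n)))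
        atTop (nhds ((1+δ) ^ (-α))) := by
      have := (hratio (1+δ) (by linarith)).mul ((hw0.const_sub 1).sub (hnF (1+δ) (by linarith)))
      simpa using this
    filter_upwards [hlim.eventually_const_lt hδa, eventually_gt_atTop 0] with n h1 hn
    refine h1.trans_le ?_
    have hn' : (0:ℝ) < n := by exact_mod_cast hn
    have h2 := lower_ineq P ξ hm hind hid n (f n) δ (w n) (hw n hn (f n) (hf n))
    rw [← hg] at h2
    have h3 := hpos (f n)
    rw [le_div_iff₀ (by positivity)]
    refine le_trans (le_of_eq ?_) h2
    field_simp
  · intro a ha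
    have hcont' : Tendsto (fun d : ℝ => (1 - d) ^ (-α)) (nhds 0) (nhds 1) := by
      have : Tendsto (fun d : ℝ => -d) (nhds 0) (nhds 0) := by
        simpa using (continuous_neg (G := ℝ)).tendsto 0
      exact hcont.comp this
    obtain ⟨δ, ⟨hδa, hδ1⟩, hδ⟩ : ∃ δ : ℝ, ((1 - δ) ^ (-α) < a ∧ δ < 1) ∧ 0 < δ :=
      ((((hcont'.eventually_lt_const ha).and (eventually_lt_nhds one_pos)).filter_mono
        nhdsWithin_le_nhds).and
        (self_mem_nhdsWithin : Ioi (0:ℝ) ∈ nhdsWithin 0 (Ioi 0))).exists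
    obtain ⟨w, hw0, hw⟩ := wlln P ξ hm hind hid hZ h0 δ hδ
    set K := 2 * ((α + 1) + 1) with hK
    have hKpos : 0 < K := by rw [hK]; linarith
    set η := (γ - 1) / 2 / K with hη
    have hηpos : 0 < η := by
      have : 0 < γ - 1 := by linarith
      positivity
    set ε := (a - (1 - δ) ^ (-α)) / 2 with hε
    have hεpos : 0 < ε := by rw [hε]; linarith
    have hev := exponent_bound g (fun s => ∫ ω, min |ξ 0 ω| (s * ξ 0 ω ^ 2) ∂P) γ (α+1) hγ (by linarith)
      (trunc_moment P (ξ 0) hZ) (fun x => (hpos x).le) C x0 hC hup c x1 hc hlow K η hK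
      (by rw [hη]; field_simp) ε hεpos
    have hlim : Tendsto (fun n : ℕ => g ((1-δ) * f n) / g (f n) + g (η * f n) / g (f n) * w n)
        atTop (nhds ((1-δ) ^ (-α))) := by
      have := (hratio (1-δ) (by linarith)).add ((hratio η hηpos).mul hw0)
      simpa using this
    filter_upwards [hlim.eventually_lt_const (show (1-δ)^(-α) < (1-δ)^(-α) + ε by linarith),
      eventually_gt_atTop 0, hftop.eventually hev] with n h1 hn h4
    have hn' : (0:ℝ) < n := by exact_mod_cast hn
    have hn1 : (1:ℝ) ≤ n := by exact_mod_cast hn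
    obtain ⟨s, hs, hsM, hexp⟩ := h4
    have h5 := chernoff_trunc P ξ hm hind hid hZ h0 s (η * f n) (f n) hs hsM n
    rw [← hg] at h5
    have h6 := h5.trans (hexp n (hf n))
    have h2 := upper_ineq P ξ hm hind hid n (f n) δ η (w n) (hw n hn (f n) (hf n))
    rw [← hg, ← hg] at h2
    have h3 := hpos (f n)
    rw [div_lt_iff₀ (by positivity)]
    have h7 : n * g ((1-δ) * f n) + n * (g (η * f n) * w n) < ((1-δ)^(-α) + ε) * (n * g (f n)) := by
      rw [← div_lt_iff₀ (by positivity)]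
      refine lt_of_eq_of_lt ?_ h1
      field_simp
    have h8 : ε * g (f n) ≤ ε * (n * g (f n)) := by
      gcongr; nlinarith
    have h9 : a = (1-δ)^(-α) + ε + ε := by rw [hε]; ring
    rw [h9]
    linarith [add_mul ((1-δ)^(-α) + ε) ε (n * g (f n))]

/-- **Proposition 3.3 (i)**: `P(X(n) > f(n)) ∼ n P(X(1) > f(n))` for `f(n) ≥ n`. -/
theorem levy_tail_asymptotics_integer_times
    {Ω : Type*} [MeasureSpace Ω] [IsProbabilityMeasure (ℙ : Measure Ω)]
    (X : ℝ → Ω → ℝ)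
    (hmeas : ∀ t : ℝ, Measurable (X t))
    (hX0 : ∀ᵐ ω ∂ℙ, X 0 ω = 0)
    (hpath : ∀ᵐ ω ∂ℙ, ∀ t : ℝ, 0 ≤ t →
      ContinuousWithinAt (fun s => X s ω) (Set.Ici t) t ∧
      (0 < t → ∃ l : ℝ, Tendsto (fun s => X s ω) (nhdsWithin t (Set.Iio t)) (nhds l)))
    (hstat : ∀ s t : ℝ, 0 ≤ s → s ≤ t →
      Measure.map (fun ω => X t ω - X s ω) ℙ = Measure.map (X (t - s)) ℙ)
    (hincr : ∀ (n : ℕ) (t : Fin (n + 1) → ℝ), (∀ i, 0 ≤ t i) → StrictMono t →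
      iIndepFun
        (fun i : Fin n => fun ω => X (t i.succ) ω - X (t i.castSucc) ω) ℙ)
    (hint : Integrable (X 1) ℙ)
    (hmean : ∫ ω, X 1 ω ∂ℙ = 0)
    (α : ℝ) (hα : 1 < α)
    (htail_pos : ∀ x : ℝ, 0 < ℙ {ω | x < X 1 ω})
    (hRV : ∀ c : ℝ, 0 < c →
      Tendsto (fun x : ℝ =>
          (ℙ {ω | c * x < X 1 ω}).toReal / (ℙ {ω | x < X 1 ω}).toReal)
        atTop (nhds (c ^ (-α))))
    (hbal : α < 2 → ∃ ρ : ℝ, 0 ≤ ρ ∧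
      Tendsto (fun x : ℝ =>
          (ℙ {ω | X 1 ω < -x}).toReal / (ℙ {ω | x < X 1 ω}).toReal)
        atTop (nhds ρ))
    (f : ℕ → ℝ) (hf : ∀ n : ℕ, (n : ℝ) ≤ f n) :
    Tendsto (fun n : ℕ =>
        (ℙ {ω | f n < X (n : ℝ) ω}).toReal
          / ((n : ℝ) * (ℙ {ω | f n < X 1 ω}).toReal))
      atTop (nhds 1) := by
  set ξ : ℕ → Ω → ℝ := fun i ω => X ((i + 1 : ℕ) : ℝ) ω - X (i : ℝ) ω with hξ
  have hm : ∀ i, Measurable (ξ i) := fun i => (hmeas _).sub (hmeas _)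
  have hid1 : ∀ i, IdentDistrib (ξ i) (X 1) ℙ ℙ := by
    intro i
    refine ⟨(hm i).aemeasurable, (hmeas 1).aemeasurable, ?_⟩
    have := hstat (i:ℝ) ((i + 1 : ℕ) : ℝ) (by positivity) (by push_cast; linarith)
    rw [show ((i + 1 : ℕ) : ℝ) - (i:ℝ) = 1 by push_cast; ring] at this
    exact this
  have hid : ∀ i, IdentDistrib (ξ i) (ξ 0) ℙ ℙ := fun i => (hid1 i).trans (hid1 0).symm
  have hind : iIndepFun ξ ℙ := by
    rw [iIndepFun_iff_finset]
    intro s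
    obtain ⟨n, hn⟩ := s.exists_nat_subset_range
    have h1 := hincr n (fun i => ((i : ℕ) : ℝ)) (fun i => by positivity)
      (fun i j hij => Nat.cast_lt.2 (Fin.lt_def.1 hij))
    have h2 := h1.precomp (g := fun i : s => (⟨i.1, Finset.mem_range.1 (hn i.2)⟩ : Fin n))
      (fun i j hij => Subtype.ext (Fin.mk.inj hij))
    exact h2
  have hsum : ∀ n : ℕ, ∀ᵐ ω ∂(ℙ : Measure Ω), ∑ i ∈ Finset.range n, ξ i ω = X (n:ℝ) ω := by
    intro n
    filter_upwards [hX0] with ω h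
    have := Finset.sum_range_sub (fun i : ℕ => X (i:ℝ) ω) n
    simp only [hξ]
    rw [this]; simp [h]
  have htail : ∀ y : ℝ, (ℙ {ω | y < X 1 ω}).toReal = (ℙ : Measure Ω).real {ω | y < ξ 0 ω} :=
    fun y => congrArg ENNReal.toReal ((hid1 0).measure_mem_eq measurableSet_Ioi).symm
  have := iid_main (ℙ : Measure Ω) ξ hm hind hid ((hid1 0).integrable_iff.2 hint)
    ((hid1 0).integral_eq.trans hmean) α hα (fun y => (ℙ {ω | y < X 1 ω}).toReal) htail
    (fun x => ENNReal.toReal_pos (htail_pos x).ne' (measure_ne_top _ _)) hRV f hf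
  refine this.congr (fun n => ?_)
  congr 1
  refine congrArg ENNReal.toReal (measure_congr ?_)
  filter_upwards [hsum n] with ω h
  have : (f n < ∑ i ∈ Finset.range n, ξ i ω) = (f n < X (n:ℝ) ω) := by rw [h]
  exact this
end

section
/- Suppose X satisfies Assumption 1. Then P(Q_e > u) · (α − 1) / (u · P(X(1) > u)) → 1 as u → ∞; that is, P(Q_e > u) ∼ (u/(α − 1)) · P(X(1) > u). -/
open MeasureTheory ProbabilityTheory Filter Set

namespace Veraverbeke

/-- regular variation data -/
structure RV (F : ℝ → ℝ) (α : ℝ) : Prop where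
  anti : Antitone F
  pos : ∀ x, 0 < F x
  lim : ∀ c : ℝ, 0 < c → Tendsto (fun x => F (c * x) / F x) atTop (nhds (c ^ (-α)))

theorem RV.lim' {F : ℝ → ℝ} {α : ℝ} (h : RV F α) {c : ℝ} (hc : 0 < c) {m : ℝ → ℝ}
    (hm : Tendsto (fun x => m x / x) atTop (nhds c)) :
    Tendsto (fun x => F (m x) / F x) atTop (nhds (c ^ (-α))) := by
  have hcont : ContinuousAt (fun y : ℝ => y ^ (-α)) c :=
    Real.continuousAt_rpow_const _ _ (Or.inl hc.ne')
  rw [tendsto_order]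
  constructor
  · intro a ha
    have h1 : ∀ᶠ y in nhdsWithin c (Ioi c), a < y ^ (-α) :=
      nhdsWithin_le_nhds (hcont.eventually (lt_mem_nhds ha))
    obtain ⟨y, hy1, hy2⟩ := (h1.and self_mem_nhdsWithin).exists
    have hy2' : c < y := hy2
    filter_upwards [(h.lim y (hc.trans hy2')).eventually (lt_mem_nhds hy1),
      hm.eventually (gt_mem_nhds hy2'), eventually_gt_atTop 0] with x hx1 hx2 hx3
    rw [div_lt_iff₀ hx3] at hx2
    exact hx1.trans_le (div_le_div_of_nonneg_right (h.anti hx2.le) (h.pos x).le)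
  · intro a ha
    have h1 : ∀ᶠ y in nhdsWithin c (Iio c), y ^ (-α) < a :=
      nhdsWithin_le_nhds (hcont.eventually (gt_mem_nhds ha))
    have h0 : ∀ᶠ y in nhdsWithin c (Iio c), 0 < y :=
      nhdsWithin_le_nhds (lt_mem_nhds hc)
    obtain ⟨y, ⟨hy1, hy0⟩, hy2⟩ := ((h1.and h0).and self_mem_nhdsWithin).exists
    have hy2' : y < c := hy2
    filter_upwards [(h.lim y hy0).eventually (gt_mem_nhds hy1),
      hm.eventually (lt_mem_nhds hy2'), eventually_gt_atTop 0] with x hx1 hx2 hx3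
    rw [lt_div_iff₀ hx3] at hx2
    exact (div_le_div_of_nonneg_right (h.anti hx2.le) (h.pos x).le).trans_lt hx1

theorem tendsto_affine_div (c d : ℝ) : Tendsto (fun x : ℝ => (c * x + d) / x) atTop (nhds c) := by
  have h1 : Tendsto (fun x : ℝ => c + d / x) atTop (nhds (c + 0)) :=
    tendsto_const_nhds.add (tendsto_const_nhds.div_atTop tendsto_id)
  rw [add_zero] at h1
  refine h1.congr' ?_
  filter_upwards [eventually_gt_atTop 0] with x hx
  field_simp

theorem RV.potter {F : ℝ → ℝ} {α : ℝ} (h : RV F α) (hα : 1 < α) :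
    ∃ x0 : ℝ, 1 ≤ x0 ∧ ∃ β : ℝ, 1 < β ∧ ∀ u, x0 ≤ u → ∀ s, 1 ≤ s →
      F (u * s) ≤ (2 ^ β * s ^ (-β)) * F u := by
  set β := (1 + α) / 2 with hβ
  have hβ1 : 1 < β := by rw [hβ]; linarith
  have hβ2 : β < α := by rw [hβ]; linarith
  have hlt : (2 : ℝ) ^ (-α) < 2 ^ (-β) :=
    Real.rpow_lt_rpow_of_exponent_lt (by norm_num) (by linarith)
  obtain ⟨x0, hx0⟩ := eventually_atTop.1
    ((h.lim 2 (by norm_num)).eventually (gt_mem_nhds hlt))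
  refine ⟨max x0 1, le_max_right _ _, β, hβ1, ?_⟩
  have key : ∀ k : ℕ, ∀ u, max x0 1 ≤ u → F (u * 2 ^ k) ≤ ((2 : ℝ) ^ k) ^ (-β) * F u := by
    intro k
    induction k with
    | zero => intro u hu; simp
    | succ k ih =>
      intro u hu
      have hu1 : 1 ≤ u := (le_max_right _ _).trans hu
      have h2 : (1 : ℝ) ≤ 2 ^ k := one_le_pow₀ (by norm_num)
      have hu' : u ≤ u * 2 ^ k := by nlinarith
      have h1 := hx0 (u * 2 ^ k) ((le_max_left _ _).trans (hu.trans hu'))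
      rw [div_lt_iff₀ (h.pos _)] at h1
      have h3 : u * 2 ^ (k + 1) = 2 * (u * 2 ^ k) := by ring
      rw [h3, pow_succ, Real.mul_rpow (by positivity) (by norm_num)]
      refine h1.le.trans ?_
      have h4 := ih u hu
      have h5 : (0 : ℝ) < 2 ^ (-β) := by positivity
      nlinarith
  intro u hu s hs
  have hu1 : 1 ≤ u := (le_max_right _ _).trans hu
  obtain ⟨k, hk1, hk2⟩ := exists_nat_pow_near hs (by norm_num : (1 : ℝ) < 2)
  have e1 : F (u * s) ≤ F (u * 2 ^ k) := h.anti (by nlinarith)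
  refine e1.trans ((key k u hu).trans ?_)
  refine mul_le_mul_of_nonneg_right ?_ (h.pos u).le
  have e2 : (2 : ℝ) ^ β * s ^ (-β) = (s / 2) ^ (-β) := by
    rw [Real.div_rpow (by linarith) (by norm_num), Real.rpow_neg (by norm_num : (0:ℝ) ≤ 2)]
    field_simp
  rw [e2]
  refine Real.rpow_le_rpow_of_nonpos (by linarith) ?_ (by linarith)
  rw [pow_succ] at hk2
  linarith

theorem RV.karamata {F : ℝ → ℝ} {α : ℝ} (h : RV F α) (hα : 1 < α) :
    Tendsto (fun y => (∫ x in Ioi y, F x) / (y * F y)) atTop (nhds (1 / (α - 1))) ∧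
    ∀ᶠ y in atTop, IntegrableOn F (Ioi y) := by
  obtain ⟨x0, hx0, β, hβ, hp⟩ := h.potter hα
  have hbint : IntegrableOn (fun s : ℝ => (2 : ℝ) ^ β * s ^ (-β)) (Ioi 1) :=
    (integrableOn_Ioi_rpow_of_lt (by linarith) one_pos).const_mul _
  have hmeas : Measurable F := h.anti.measurable
  have hbound : ∀ u, x0 ≤ u → ∀ᵐ s ∂(volume.restrict (Ioi (1:ℝ))),
      ‖F (u * s) / F u‖ ≤ (2 : ℝ) ^ β * s ^ (-β) := by
    intro u hu
    refine (ae_restrict_iff' measurableSet_Ioi).2 (Eventually.of_forall fun s hs => ?_)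
    rw [Real.norm_of_nonneg (div_nonneg (h.pos _).le (h.pos _).le), div_le_iff₀ (h.pos _)]
    exact hp u hu s (le_of_lt hs)
  have hm1 : ∀ u, Measurable (fun s => F (u * s) / F u) := fun u =>
    (hmeas.comp (measurable_const_mul u)).div_const _
  constructor
  · have := tendsto_integral_filter_of_dominated_convergence
      (μ := volume.restrict (Ioi (1:ℝ))) (l := atTop)
      (F := fun u s => F (u * s) / F u) (f := fun s => s ^ (-α))
      (fun s : ℝ => (2 : ℝ) ^ β * s ^ (-β))
      (Eventually.of_forall fun u => (hm1 u).aestronglyMeasurable)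
      ((eventually_ge_atTop x0).mono hbound) hbint
      ((ae_restrict_iff' measurableSet_Ioi).2 (Eventually.of_forall fun s hs => by
        have h1 := h.lim s (lt_trans one_pos hs)
        simpa only [mul_comm] using h1))
    rw [integral_Ioi_rpow_of_lt (by linarith) one_pos] at this
    have e : -(1:ℝ) ^ (-α + 1) / (-α + 1) = 1 / (α - 1) := by
      rw [Real.one_rpow, neg_div, ← div_neg]; congr 1; ring
    rw [e] at this
    refine this.congr' ?_
    filter_upwards [eventually_gt_atTop 0] with u hu
    rw [integral_div, integral_comp_mul_left_Ioi F 1 hu]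
    have := (h.pos u).ne'
    rw [mul_one, smul_eq_mul]
    field_simp
  · filter_upwards [eventually_ge_atTop x0] with u hu
    have hu0 : 0 < u := by linarith
    have h1 : IntegrableOn (fun s => F (u * s) / F u) (Ioi 1) :=
      Integrable.mono' hbint (hm1 u).aestronglyMeasurable (hbound u hu)
    have h2 : IntegrableOn (fun s => F (u * s)) (Ioi 1) := by
      have := h1.mul_const (F u)
      refine Integrable.congr this (Eventually.of_forall fun s => ?_)
      have := (h.pos u).ne'
      simp only []
      field_simp
    rwa [integrableOn_Ioi_comp_mul_left_iff F 1 hu0, mul_one] at h2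

theorem RV.sum_bounds {F : ℝ → ℝ} {α : ℝ} (h : RV F α) {b : ℝ} (hb : 0 < b) {y : ℝ}
    (hy : IntegrableOn F (Ioi y)) :
    Summable (fun n : ℕ => F (y + b * n)) ∧
    b⁻¹ * (∫ x in Ioi y, F x) ≤ ∑' n : ℕ, F (y + b * n) ∧
    ∑' n : ℕ, F (y + b * n) ≤ F y + b⁻¹ * (∫ x in Ioi y, F x) := by
  have hanti : Antitone (fun t => F (b * t)) := fun s t hst =>
    h.anti (mul_le_mul_of_nonneg_left hst hb.le)
  have eby : b * (y / b) = y := by field_simp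
  have hI : IntegrableOn (fun t => F (b * t)) (Ioi (y / b)) := by
    rw [integrableOn_Ioi_comp_mul_left_iff F _ hb, eby]; exact hy
  have hJ : ∫ t in Ioi (y / b), F (b * t) = b⁻¹ * (∫ x in Ioi y, F x) := by
    rw [integral_comp_mul_left_Ioi F _ hb, eby, smul_eq_mul]
  rw [← hJ]
  have hpt : ∀ i : ℕ, F (b * (y / b + i)) = F (y + b * i) := by
    intro i; rw [mul_add, eby]
  have hfin : ∀ N : ℕ, ∑ i ∈ Finset.range N, F (y + b * (i + 1 : ℕ)) ≤
      ∫ t in Ioi (y / b), F (b * t) := by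
    intro N
    have h1 := AntitoneOn.sum_le_integral (x₀ := y / b) (a := N) (hanti.antitoneOn _)
    simp only [hpt] at h1
    refine h1.trans ?_
    rw [intervalIntegral.integral_of_le (by simp)]
    exact setIntegral_mono_set hI (Eventually.of_forall fun t => (h.pos _).le)
      (Eventually.of_forall fun t ht => ht.1)
  have hs' : Summable (fun n : ℕ => F (y + b * (n + 1 : ℕ))) :=
    summable_of_sum_range_le (fun n => (h.pos _).le) hfin
  have hs : Summable (fun n : ℕ => F (y + b * n)) :=
    (summable_nat_add_iff (f := fun n : ℕ => F (y + b * n)) 1).1 hs'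
  refine ⟨hs, ?_, ?_⟩
  · have ht : Tendsto (fun N : ℕ => y / b + (N : ℝ)) atTop atTop :=
      tendsto_atTop_add_const_left _ _ tendsto_natCast_atTop_atTop
    refine le_of_tendsto (intervalIntegral_tendsto_integral_Ioi _ hI ht)
      (Eventually.of_forall fun N => ?_)
    have h1 := AntitoneOn.integral_le_sum (x₀ := y / b) (a := N) (hanti.antitoneOn _)
    simp only [hpt] at h1
    exact h1.trans (hs.sum_le_tsum _ fun i _ => (h.pos _).le)
  · rw [hs.tsum_eq_zero_add]
    have : ∑' n : ℕ, F (y + b * (n + 1 : ℕ)) ≤ ∫ t in Ioi (y / b), F (b * t) :=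
      Real.tsum_le_of_sum_range_le (fun n => (h.pos _).le) hfin
    simpa using this

theorem RV.sum_asymp0 {F : ℝ → ℝ} {α : ℝ} (h : RV F α) (hα : 1 < α) {b : ℝ} (hb : 0 < b) :
    Tendsto (fun y => (∑' n : ℕ, F (y + b * n)) / (y * F y)) atTop
      (nhds (1 / (b * (α - 1)))) := by
  obtain ⟨hk, hi⟩ := h.karamata hα
  have e : b⁻¹ * (1 / (α - 1)) = 1 / (b * (α - 1)) := by
    rw [one_div, one_div, mul_inv]
  have l1 : Tendsto (fun y => b⁻¹ * ((∫ x in Ioi y, F x) / (y * F y))) atTop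
      (nhds (1 / (b * (α - 1)))) := by
    rw [← e]; exact hk.const_mul _
  have l2 : Tendsto (fun y => 1 / y + b⁻¹ * ((∫ x in Ioi y, F x) / (y * F y))) atTop
      (nhds (1 / (b * (α - 1)))) := by
    have := (tendsto_const_nhds (x := (1:ℝ)).div_atTop tendsto_id).add l1
    simpa using this
  refine tendsto_of_tendsto_of_tendsto_of_le_of_le' l1 l2 ?_ ?_
  · filter_upwards [hi, eventually_gt_atTop 0] with y hy hy0
    have := (h.sum_bounds hb hy).2.1
    rw [← mul_div_assoc]
    exact div_le_div_of_nonneg_right this (mul_pos hy0 (h.pos y)).le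
  · filter_upwards [hi, eventually_gt_atTop 0] with y hy hy0
    have h2 := (h.sum_bounds hb hy).2.2
    have h3 := h.pos y
    have : 1 / y + b⁻¹ * ((∫ x in Ioi y, F x) / (y * F y)) =
      (F y + b⁻¹ * (∫ x in Ioi y, F x)) / (y * F y) := by field_simp
    rw [this]
    exact div_le_div_of_nonneg_right h2 (mul_pos hy0 (h.pos y)).le

theorem RV.A_asymp {F : ℝ → ℝ} {α : ℝ} (h : RV F α) {c : ℝ} (hc : 0 < c) (d : ℝ) :
    Tendsto (fun x => ((c * x + d) * F (c * x + d)) / (x * F x)) atTop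
      (nhds (c ^ (1 - α))) := by
  have h1 := tendsto_affine_div c d
  have h2 := h1.mul (h.lim' hc h1)
  have e : c * c ^ (-α) = c ^ (1 - α) := by
    rw [Real.rpow_sub hc, Real.rpow_one, Real.rpow_neg hc.le]; rfl
  rw [e] at h2
  refine h2.congr fun x => ?_
  rw [div_mul_div_comm]

theorem RV.sum_asymp {F : ℝ → ℝ} {α : ℝ} (h : RV F α) (hα : 1 < α) {b : ℝ} (hb : 0 < b)
    {c : ℝ} (hc : 0 < c) (d : ℝ) :
    Tendsto (fun x => (∑' n : ℕ, F (c * x + d + b * n)) / (x * F x)) atTop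
      (nhds (c ^ (1 - α) / (b * (α - 1)))) := by
  have ht : Tendsto (fun x : ℝ => c * x + d) atTop atTop :=
    tendsto_atTop_add_const_right _ _ (tendsto_id.const_mul_atTop hc)
  have h1 := ((h.sum_asymp0 hα hb).comp ht).mul (h.A_asymp hc d)
  have e : 1 / (b * (α - 1)) * c ^ (1 - α) = c ^ (1 - α) / (b * (α - 1)) := by ring
  rw [e] at h1
  refine h1.congr' ?_
  filter_upwards [eventually_gt_atTop 0, ht.eventually (eventually_gt_atTop 0)] with x hx hx2
  have := (h.pos x).ne'
  have := (h.pos (c * x + d)).ne'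
  simp only [Function.comp]
  field_simp

theorem RV.summable {F : ℝ → ℝ} {α : ℝ} (h : RV F α) (hα : 1 < α) {b : ℝ} (hb : 0 < b)
    {c : ℝ} (hc : 0 < c) (d : ℝ) :
    ∀ᶠ x in atTop, Summable (fun n : ℕ => F (c * x + d + b * n)) := by
  have ht : Tendsto (fun x : ℝ => c * x + d) atTop atTop :=
    tendsto_atTop_add_const_right _ _ (tendsto_id.const_mul_atTop hc)
  exact (ht.eventually (h.karamata hα).2).mono fun x hx => (h.sum_bounds hb hx).1

theorem fixed_point_bound {g : ℝ → ℝ} {η x0 κ1 κ2 K1 C0 K : ℝ} (hη : 0 < η) (hη2 : η < 1 / 2)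
    (hx0 : 0 < x0) (hκ1 : 0 ≤ κ1) (hκ2 : 0 ≤ κ2) (hκ : κ1 + κ2 < 1)
    (hrec : ∀ x, x0 ≤ x → g x ≤ K1 + κ1 * g ((1 - η) * x) + κ2 * g (η * x))
    (hC0 : ∀ x, η * x0 ≤ x → x ≤ x0 → g x ≤ C0) (hK : K1 / (1 - (κ1 + κ2)) < K) :
    ∀ᶠ x in atTop, g x ≤ K := by
  set κ := κ1 + κ2 with hκdef
  have h1κ : 0 < 1 - κ := by linarith
  have hκ0 : 0 ≤ κ := by positivity
  set Kf := K1 / (1 - κ) with hKf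
  have hKf' : K1 + κ * Kf = Kf := by rw [hKf]; field_simp; ring
  set C := max C0 Kf with hC
  have hCf : K1 + κ * C ≤ C := by
    have h1 : Kf ≤ C := le_max_right _ _
    nlinarith
  have h1η : 0 < 1 - η := by linarith
  -- boundedness
  have hb1 : ∀ n : ℕ, ∀ x, η * x0 ≤ x → (1 - η) ^ n * x ≤ x0 → g x ≤ C := by
    intro n
    induction n with
    | zero => intro x h1 h2; exact (hC0 x h1 (by simpa using h2)).trans (le_max_left _ _)
    | succ n ih =>
      intro x h1 h2
      rcases le_total x x0 with hx | hx
      · exact (hC0 x h1 hx).trans (le_max_left _ _)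
      · have hxpos : 0 < x := hx0.trans_le hx
        have hηx : η * x ≤ (1 - η) * x := by nlinarith
        have e1 : (1 - η) ^ n * ((1 - η) * x) ≤ x0 := by rw [← mul_assoc, ← pow_succ]; exact h2
        have hp : 0 < (1 - η) ^ n := by positivity
        have e0 : η * x0 ≤ η * x := by nlinarith
        have a1 := ih ((1 - η) * x) (e0.trans hηx) e1
        have a2 := ih (η * x) e0 ((mul_le_mul_of_nonneg_left hηx hp.le).trans e1)
        have := hrec x hx
        have b1 := mul_le_mul_of_nonneg_left a1 hκ1
        have b2 := mul_le_mul_of_nonneg_left a2 hκ2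
        have : κ * C = κ1 * C + κ2 * C := by rw [hκdef]; ring
        linarith
  have hb : ∀ x, η * x0 ≤ x → g x ≤ C := by
    intro x hx
    have ht : Tendsto (fun n : ℕ => (1 - η) ^ n * x) atTop (nhds (0 * x)) :=
      (tendsto_pow_atTop_nhds_zero_of_lt_one h1η.le (by linarith)).mul_const x
    rw [zero_mul] at ht
    obtain ⟨n, hn⟩ := (ht.eventually (gt_mem_nhds hx0)).exists
    exact hb1 n x hx hn.le
  -- iteration
  have hit : ∀ n : ℕ, ∀ᶠ x in atTop, g x ≤ Kf + κ ^ n * (C - Kf) := by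
    intro n
    induction n with
    | zero =>
      filter_upwards [eventually_ge_atTop (η * x0)] with x hx
      have := hb x hx
      simpa using this
    | succ n ih =>
      have t1 : Tendsto (fun x : ℝ => (1 - η) * x) atTop atTop := tendsto_id.const_mul_atTop h1η
      have t2 : Tendsto (fun x : ℝ => η * x) atTop atTop := tendsto_id.const_mul_atTop hη
      filter_upwards [t1.eventually ih, t2.eventually ih, eventually_ge_atTop x0] with x a1 a2 hx
      have := hrec x hx
      have b1 := mul_le_mul_of_nonneg_left a1 hκ1
      have b2 := mul_le_mul_of_nonneg_left a2 hκ2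
      calc g x ≤ K1 + κ1 * (Kf + κ ^ n * (C - Kf)) + κ2 * (Kf + κ ^ n * (C - Kf)) := by linarith
        _ = (K1 + κ * Kf) + κ ^ (n + 1) * (C - Kf) := by rw [hκdef]; ring
        _ = _ := by rw [hKf']
  have ht : Tendsto (fun n : ℕ => Kf + κ ^ n * (C - Kf)) atTop (nhds (Kf + 0 * (C - Kf))) :=
    ((tendsto_pow_atTop_nhds_zero_of_lt_one hκ0 hκ).mul_const _).const_add _
  rw [zero_mul, add_zero] at ht
  obtain ⟨n, hn⟩ := (ht.eventually (gt_mem_nhds hK)).exists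
  exact (hit n).mono fun x hx => hx.trans hn.le

theorem RV.upper {F : ℝ → ℝ} {α : ℝ} (h : RV F α) (hα : 1 < α) {G : ℝ → ℝ}
    (hG0 : ∀ x, 0 ≤ G x) (hG1 : ∀ x, G x ≤ 1) (hGlim : Tendsto G atTop (nhds 0))
    (hrec : ∀ η : ℝ, 0 < η → η < 1 / 2 → ∃ r : ℝ, ∀ᶠ x in atTop,
      G x ≤ (∑' n : ℕ, F ((1 - η) * x + r + (1 - η) * n)) + η * G ((1 - η) * x)
        + G (η * x) * G (η * x))
    {K : ℝ} (hK : 1 / (α - 1) < K) : ∀ᶠ x in atTop, G x / (x * F x) ≤ K := by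
  have hα1 : 0 < α - 1 := by linarith
  -- choose η
  have hpow : ContinuousAt (fun η : ℝ => (1 - η) ^ (1 - α)) 0 := by
    refine ContinuousAt.rpow_const (by fun_prop) (Or.inl (by norm_num))
  have hc1 : ContinuousAt (fun η : ℝ => ((1 - η) ^ (1 - α) / ((1 - η) * (α - 1)) + η) /
      (1 - (η * ((1 - η) ^ (1 - α) + 1) + η))) 0 := by
    refine ContinuousAt.div (ContinuousAt.add (ContinuousAt.div hpow (by fun_prop) ?_)
      continuousAt_id) ?_ ?_
    · simp; exact hα1.ne'
    · exact continuousAt_const.sub ((continuousAt_id.mul (hpow.add continuousAt_const)).add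
        continuousAt_id)
    · simp
  have hc2 : ContinuousAt (fun η : ℝ => η * ((1 - η) ^ (1 - α) + 1) + η) 0 :=
    (continuousAt_id.mul (hpow.add continuousAt_const)).add continuousAt_id
  have v1 : ∀ᶠ η in nhdsWithin (0:ℝ) (Ioi 0), ((1 - η) ^ (1 - α) / ((1 - η) * (α - 1)) + η) /
      (1 - (η * ((1 - η) ^ (1 - α) + 1) + η)) < K := by
    refine nhdsWithin_le_nhds (hc1.eventually (gt_mem_nhds ?_))
    simpa using hK
  have v2 : ∀ᶠ η in nhdsWithin (0:ℝ) (Ioi 0), η * ((1 - η) ^ (1 - α) + 1) + η < 1 := by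
    refine nhdsWithin_le_nhds (hc2.eventually (gt_mem_nhds ?_))
    simp
  have v3 : ∀ᶠ η in nhdsWithin (0:ℝ) (Ioi 0), η < 1 / 2 :=
    nhdsWithin_le_nhds (gt_mem_nhds (by norm_num))
  obtain ⟨η, ⟨⟨w1, w2⟩, w3⟩, w4⟩ := (((v1.and v2).and v3).and self_mem_nhdsWithin).exists
  have hη : 0 < η := w4
  have h1η : 0 < 1 - η := by linarith
  obtain ⟨r, hr⟩ := hrec η hη w3
  have s1 : ∀ᶠ x in atTop, (∑' n : ℕ, F ((1 - η) * x + r + (1 - η) * n)) / (x * F x)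
      < (1 - η) ^ (1 - α) / ((1 - η) * (α - 1)) + η :=
    (h.sum_asymp hα h1η h1η r).eventually (gt_mem_nhds (by linarith))
  have s2 : ∀ᶠ x in atTop, (((1 - η) * x + 0) * F ((1 - η) * x + 0)) / (x * F x) <
      (1 - η) ^ (1 - α) + 1 :=
    (h.A_asymp h1η 0).eventually (gt_mem_nhds (by linarith))
  have t2 : Tendsto (fun x : ℝ => η * x) atTop atTop := tendsto_id.const_mul_atTop hη
  have s3 : ∀ᶠ x in atTop, G (η * x) * (((η * x + 0) * F (η * x + 0)) / (x * F x)) < η := by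
    have := (hGlim.comp t2).mul (h.A_asymp hη 0)
    rw [zero_mul] at this
    exact this.eventually (gt_mem_nhds hη)
  obtain ⟨x1, hx1⟩ := eventually_atTop.1 (((hr.and s1).and s2).and s3)
  set x0 := max x1 1 with hx0
  have hx0pos : 0 < x0 := lt_of_lt_of_le one_pos (le_max_right _ _)
  refine fixed_point_bound (g := fun x => G x / (x * F x)) (x0 := x0)
    (κ1 := η * ((1 - η) ^ (1 - α) + 1)) (κ2 := η) (C0 := 1 / (η * x0 * F x0))
    hη w3 hx0pos (by positivity) hη.le w2 ?_ ?_ w1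
  · intro x hx
    have hxp : 0 < x := hx0pos.trans_le hx
    obtain ⟨⟨⟨b0, b1⟩, b2⟩, b3⟩ := hx1 x ((le_max_left _ _).trans hx)
    simp only [add_zero] at b2 b3
    have p0 := h.pos x
    have p1 := h.pos ((1 - η) * x)
    have p2 := h.pos (η * x)
    have A0 : 0 < x * F x := by positivity
    have A1 : 0 < (1 - η) * x * F ((1 - η) * x) := by positivity
    have A2 : 0 < η * x * F (η * x) := by positivity
    have g1 : 0 ≤ G ((1 - η) * x) / ((1 - η) * x * F ((1 - η) * x)) := div_nonneg (hG0 _) A1.le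
    have g2 : 0 ≤ G (η * x) / (η * x * F (η * x)) := div_nonneg (hG0 _) A2.le
    have c0 := div_le_div_of_nonneg_right b0 A0.le
    rw [add_div, add_div] at c0
    have c1 : η * G ((1 - η) * x) / (x * F x) =
      η * (((1 - η) * x * F ((1 - η) * x)) / (x * F x)) *
        (G ((1 - η) * x) / ((1 - η) * x * F ((1 - η) * x))) := by field_simp
    have c2 : G (η * x) * G (η * x) / (x * F x) =
      (G (η * x) * ((η * x * F (η * x)) / (x * F x))) *
        (G (η * x) / (η * x * F (η * x))) := by field_simp
    rw [c1, c2] at c0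
    have d1 := mul_le_mul_of_nonneg_right (mul_le_mul_of_nonneg_left b2.le hη.le) g1
    have d2 := mul_le_mul_of_nonneg_right b3.le g2
    linarith
  · intro x h1 h2
    have hη0 : 0 < η * x0 := by positivity
    have p0 := h.pos x0
    have hxp : 0 < x := hη0.trans_le h1
    refine div_le_div₀ zero_le_one (hG1 x) (by positivity) ?_
    exact mul_le_mul h1 (h.anti h2) p0.le hxp.le

theorem RV.lower {F : ℝ → ℝ} {α : ℝ} (h : RV F α) (hα : 1 < α) {G : ℝ → ℝ}
    (hGlim : Tendsto G atTop (nhds 0))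
    (hlow : ∀ δ : ℝ, 0 < δ → δ < 1 / 2 → ∃ r : ℝ, ∀ᶠ x in atTop,
      (1 - δ - G x) * (∑' n : ℕ, F (x + r + (1 + δ) * n)) ≤ G x)
    {K : ℝ} (hK : K < 1 / (α - 1)) : ∀ᶠ x in atTop, K < G x / (x * F x) := by
  have hα1 : 0 < α - 1 := by linarith
  have hc1 : ContinuousAt (fun δ : ℝ => (1 - δ) * (1 / ((1 + δ) * (α - 1)))) 0 := by
    refine ContinuousAt.mul (by fun_prop) (ContinuousAt.div continuousAt_const (by fun_prop) ?_)
    simp; exact hα1.ne'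
  have v1 : ∀ᶠ δ in nhdsWithin (0:ℝ) (Ioi 0), K < (1 - δ) * (1 / ((1 + δ) * (α - 1))) := by
    refine nhdsWithin_le_nhds (hc1.eventually (lt_mem_nhds ?_))
    simpa using hK
  have v3 : ∀ᶠ η in nhdsWithin (0:ℝ) (Ioi 0), η < 1 / 2 :=
    nhdsWithin_le_nhds (gt_mem_nhds (by norm_num))
  obtain ⟨δ, ⟨w1, w3⟩, w4⟩ := ((v1.and v3).and self_mem_nhdsWithin).exists
  have hδ : 0 < δ := w4
  obtain ⟨r, hr⟩ := hlow δ hδ w3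
  have l1 := (hGlim.const_sub (1 - δ)).mul (h.sum_asymp hα (b := 1 + δ) (by linarith) one_pos r)
  simp only [sub_zero, Real.one_rpow, one_mul] at l1
  filter_upwards [l1.eventually (lt_mem_nhds w1), hr, eventually_gt_atTop 0] with x h1 h2 h3
  refine h1.trans_le ?_
  rw [← mul_div_assoc]
  exact div_le_div_of_nonneg_right h2 (mul_pos h3 (h.pos x)).le

section nomeas

variable {Ω : Type*}

/-- first passage event -/
def firstP (f : ℕ → Ω → ℝ) (r : ℝ) (n : ℕ) : Set Ω := {ω | (∀ j < n, f j ω ≤ r) ∧ r < f n ω}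

theorem firstP_disjoint (f : ℕ → Ω → ℝ) (r : ℝ) :
    Pairwise (Function.onFun Disjoint (firstP f r)) := by
  intro m n hmn
  refine Set.disjoint_left.2 fun ω h1 h2 => ?_
  rcases lt_or_gt_of_ne hmn with h | h
  · exact absurd h1.2 (not_lt.2 (h2.1 m h))
  · exact absurd h2.2 (not_lt.2 (h1.1 n h))

theorem exists_firstP {f : ℕ → Ω → ℝ} {r : ℝ} {ω : Ω} {m : ℕ} (h : r < f m ω) :
    ∃ n ≤ m, ω ∈ firstP f r n := by
  classical
  have hex : ∃ n, r < f n ω := ⟨m, h⟩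
  refine ⟨Nat.find hex, Nat.find_min' hex h, ?_, Nat.find_spec hex⟩
  intro j hj
  exact not_lt.1 (Nat.find_min hex hj)

theorem measurableSet_all {m : MeasurableSpace Ω} {f : ℕ → Ω → ℝ} {r : ℝ} {n : ℕ}
    (hf : ∀ j < n, Measurable (f j)) : MeasurableSet {ω | ∀ j < n, f j ω ≤ r} := by
  have : {ω | ∀ j < n, f j ω ≤ r} = ⋂ j, ⋂ (_ : j < n), {ω | f j ω ≤ r} := by ext; simp
  rw [this]
  exact MeasurableSet.iInter fun j => MeasurableSet.iInter fun hj =>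
    measurableSet_le (hf j hj) measurable_const

theorem measurableSet_firstP {m : MeasurableSpace Ω} {f : ℕ → Ω → ℝ} {r : ℝ} {n : ℕ}
    (hf : ∀ j ≤ n, Measurable (f j)) : MeasurableSet (firstP f r n) :=
  (measurableSet_all fun j hj => hf j hj.le).inter
    (measurableSet_lt measurable_const (hf n le_rfl))

theorem measurableSet_ex {m : MeasurableSpace Ω} {f : ℕ → Ω → ℝ} {r : ℝ}
    (hf : ∀ j, Measurable (f j)) : MeasurableSet {ω | ∃ j, r < f j ω} := by
  rw [ofPred_exists]
  exact MeasurableSet.iUnion fun i => measurableSet_lt measurable_const (hf i)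

/-- partial sums -/
def S (ξ : ℕ → Ω → ℝ) (n : ℕ) (ω : Ω) : ℝ := ∑ i ∈ Finset.range n, ξ i ω

/-- past sigma-algebra -/
def past (ξ : ℕ → Ω → ℝ) (n : ℕ) : MeasurableSpace Ω :=
  ⨆ i ∈ Iio n, MeasurableSpace.comap (ξ i) inferInstance

/-- future sigma-algebra -/
def fut (ξ : ℕ → Ω → ℝ) (n : ℕ) : MeasurableSpace Ω :=
  ⨆ i ∈ Ici n, MeasurableSpace.comap (ξ i) inferInstance

theorem past_meas (ξ : ℕ → Ω → ℝ) {n i : ℕ} (h : i < n) : Measurable[past ξ n] (ξ i) :=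
  measurable_iff_comap_le.2 (le_iSup₂_of_le (f := fun i (_ : i ∈ Iio n) =>
    MeasurableSpace.comap (ξ i) inferInstance) i h le_rfl)

theorem fut_meas (ξ : ℕ → Ω → ℝ) {n i : ℕ} (h : n ≤ i) : Measurable[fut ξ n] (ξ i) :=
  measurable_iff_comap_le.2 (le_iSup₂_of_le (f := fun i (_ : i ∈ Ici n) =>
    MeasurableSpace.comap (ξ i) inferInstance) i h le_rfl)

theorem S_meas {m : MeasurableSpace Ω} {ξ : ℕ → Ω → ℝ} {n : ℕ} (h : ∀ i < n, Measurable (ξ i)) :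
    Measurable (S ξ n) :=
  Finset.measurable_sum _ fun i hi => h i (Finset.mem_range.1 hi)

/-- the walk with drift -1 -/
def W (ξ : ℕ → Ω → ℝ) (n : ℕ) (ω : Ω) : ℝ := S ξ n ω - n

/-- the exceedance event -/
def E (ξ : ℕ → Ω → ℝ) (x : ℝ) : Set Ω := {ω | ∃ n, x < W ξ n ω}

theorem E_meas {m : MeasurableSpace Ω} {ξ : ℕ → Ω → ℝ} (h : ∀ i, Measurable (ξ i)) (x : ℝ) :
    MeasurableSet (E ξ x) :=
  measurableSet_ex fun _ => (S_meas fun i _ => h i).sub_const _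

theorem meas_sub_const {m : MeasurableSpace Ω} {f : Ω → ℝ} (hf : Measurable f) (c : ℝ) :
    Measurable (fun ω => f ω - c) := hf.sub_const c

theorem meas_neg_sub_const {m : MeasurableSpace Ω} {f : Ω → ℝ} (hf : Measurable f) (c : ℝ) :
    Measurable (fun ω => - f ω - c) := hf.neg.sub_const c

end nomeas

section prob

variable {Ω : Type*} [MeasurableSpace Ω] {μ : Measure Ω} [IsProbabilityMeasure μ]

theorem tail_small {ι : Type*} [Countable ι] {f : ι → Ω → ℝ} (hf : ∀ i, Measurable (f i))
    (hb : ∀ᵐ ω ∂μ, BddAbove (range fun i => f i ω)) :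
    Tendsto (fun r : ℝ => μ.real {ω | ∃ i, r < f i ω}) atTop (nhds 0) := by
  have hm : ∀ r : ℝ, MeasurableSet {ω | ∃ i, r < f i ω} := by
    intro r
    rw [ofPred_exists]
    exact MeasurableSet.iUnion fun i => measurableSet_lt measurable_const (hf i)
  have h1 := tendsto_measure_iInter_atTop (μ := μ) (s := fun r : ℝ => {ω | ∃ i, r < f i ω})
    (fun r => (hm r).nullMeasurableSet)
    (fun r s hrs ω hω => by obtain ⟨i, hi⟩ := hω; exact ⟨i, hrs.trans_lt hi⟩)
    ⟨0, measure_ne_top _ _⟩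
  have h2 : μ (⋂ r : ℝ, {ω | ∃ i, r < f i ω}) = 0 := by
    refine measure_mono_null ?_ hb
    intro ω hω hbd
    obtain ⟨C, hC⟩ := hbd
    obtain ⟨i, hi⟩ := mem_iInter.1 hω C
    exact absurd (hC ⟨i, rfl⟩) (not_le.2 hi)
  rw [h2] at h1
  have := (ENNReal.tendsto_toReal ENNReal.zero_ne_top).comp h1
  simpa [Measure.real, Function.comp_def] using this

/-- i.i.d. sequence -/
structure IID (ξ : ℕ → Ω → ℝ) (μ : Measure Ω) : Prop where
  meas : ∀ i, Measurable (ξ i)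
  indep : iIndepFun ξ μ
  ident : ∀ i, μ.map (ξ i) = μ.map (ξ 0)

theorem IID.inter {ξ : ℕ → Ω → ℝ} (h : IID ξ μ) (n : ℕ) {A B : Set Ω}
    (hA : MeasurableSet[past ξ n] A) (hB : MeasurableSet[fut ξ n] B) :
    μ (A ∩ B) = μ A * μ B := by
  have h1 : Indep (past ξ n) (fut ξ n) μ :=
    indep_iSup_of_disjoint (fun i => (h.meas i).comap_le) h.indep
      (Set.disjoint_left.2 fun i hi hj => absurd (mem_Iio.1 hi) (not_lt.2 (mem_Ici.1 hj)))
  exact (Indep_iff _ _ _).1 h1 A B hA hB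

theorem IID.shift {ξ : ℕ → Ω → ℝ} (h : IID ξ μ) (n : ℕ) : IID (fun i => ξ (n + i)) μ where
  meas i := h.meas _
  indep := h.indep.precomp (g := fun i => n + i) (add_right_injective n)
  ident i := (h.ident _).trans (h.ident _).symm

theorem IID.map_eq {ξ ζ : ℕ → Ω → ℝ} (h : IID ξ μ) (h' : IID ζ μ)
    (h0 : μ.map (ξ 0) = μ.map (ζ 0)) :
    μ.map (fun ω i => ξ i ω) = μ.map (fun ω i => ζ i ω) := by
  rw [(iIndepFun_iff_map_fun_eq_infinitePi_map h.meas).1 h.indep,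
    (iIndepFun_iff_map_fun_eq_infinitePi_map h'.meas).1 h'.indep]
  congr 1
  ext1 i
  rw [h.ident, h'.ident, h0]

theorem IID.E_shift {ξ : ℕ → Ω → ℝ} (h : IID ξ μ) (n : ℕ) (x : ℝ) :
    μ (E (fun i => ξ (n + i)) x) = μ (E ξ x) := by
  have h1 := IID.map_eq (h.shift n) h (h.ident _)
  have hm : MeasurableSet (E (fun i (a : ℕ → ℝ) => a i) x) :=
    E_meas (fun i => measurable_pi_apply i) x
  have h2 := congrArg (fun ν => ν (E (fun i (a : ℕ → ℝ) => a i) x)) h1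
  rwa [Measure.map_apply (measurable_pi_iff.2 (h.shift n).meas) hm,
    Measure.map_apply (measurable_pi_iff.2 h.meas) hm] at h2

theorem IID.tail {ξ : ℕ → Ω → ℝ} (h : IID ξ μ) (n : ℕ) (x : ℝ) :
    μ {ω | x < ξ n ω} = μ {ω | x < ξ 0 ω} := by
  have h2 := congrArg (fun ν => ν (Ioi x)) (h.ident n)
  rwa [Measure.map_apply (h.meas n) measurableSet_Ioi,
    Measure.map_apply (h.meas 0) measurableSet_Ioi] at h2

theorem IID.slln {ξ : ℕ → Ω → ℝ} (h : IID ξ μ) (hint : Integrable (ξ 0) μ)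
    (hmean : ∫ ω, ξ 0 ω ∂μ = 0) :
    ∀ᵐ ω ∂μ, Tendsto (fun n : ℕ => S ξ n ω / n) atTop (nhds 0) := by
  have := strong_law_ae_real ξ hint (fun i j hij => h.indep.indepFun hij)
    (fun i => ⟨(h.meas i).aemeasurable, (h.meas 0).aemeasurable, h.ident i⟩)
  rwa [hmean] at this

theorem IID.up_small {ξ : ℕ → Ω → ℝ} (h : IID ξ μ) (hint : Integrable (ξ 0) μ)
    (hmean : ∫ ω, ξ 0 ω ∂μ = 0) {δ : ℝ} (hδ : 0 < δ) :
    Tendsto (fun r : ℝ => μ.real {ω | ∃ n : ℕ, r < S ξ n ω - δ * n}) atTop (nhds 0) := by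
  refine tail_small (f := fun n ω => S ξ n ω - δ * n)
    (fun n => (S_meas fun i _ => h.meas i).sub_const _) ?_
  filter_upwards [h.slln hint hmean] with ω hω
  refine IsBoundedUnder.bddAbove_range ⟨0, ?_⟩
  rw [eventually_map]
  filter_upwards [hω.eventually (gt_mem_nhds hδ), eventually_gt_atTop 0] with n hn hn0
  have : (0:ℝ) < n := by exact_mod_cast hn0
  rw [div_lt_iff₀ this] at hn
  linarith

theorem IID.down_small {ξ : ℕ → Ω → ℝ} (h : IID ξ μ) (hint : Integrable (ξ 0) μ)
    (hmean : ∫ ω, ξ 0 ω ∂μ = 0) {δ : ℝ} (hδ : 0 < δ) :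
    Tendsto (fun r : ℝ => μ.real {ω | ∃ n : ℕ, r < - S ξ n ω - δ * n}) atTop (nhds 0) := by
  refine tail_small (f := fun n ω => - S ξ n ω - δ * n)
    (fun n => (S_meas fun i _ => h.meas i).neg.sub_const _) ?_
  filter_upwards [h.slln hint hmean] with ω hω
  refine IsBoundedUnder.bddAbove_range ⟨0, ?_⟩
  rw [eventually_map]
  filter_upwards [hω.eventually (lt_mem_nhds (neg_lt_zero.2 hδ)), eventually_gt_atTop 0]
    with n hn hn0
  have : (0:ℝ) < n := by exact_mod_cast hn0
  rw [lt_div_iff₀ this] at hn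
  linarith

theorem IID.G_small {ξ : ℕ → Ω → ℝ} (h : IID ξ μ) (hint : Integrable (ξ 0) μ)
    (hmean : ∫ ω, ξ 0 ω ∂μ = 0) :
    Tendsto (fun r : ℝ => μ.real (E ξ r)) atTop (nhds 0) := by
  have := h.up_small hint hmean one_pos
  simpa [E, W] using this

theorem IID.lower {ξ : ℕ → Ω → ℝ} (h : IID ξ μ) (hint : Integrable (ξ 0) μ)
    (hmean : ∫ ω, ξ 0 ω ∂μ = 0) (δ : ℝ) (hδ : 0 < δ) (hδ2 : δ < 1 / 2) :
    ∃ r : ℝ, ∀ᶠ x in atTop,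
      (1 - δ - μ.real (E ξ x)) * (∑' n : ℕ, μ.real {ω | x + r + (1 + δ) * n < ξ 0 ω})
        ≤ μ.real (E ξ x) := by
  obtain ⟨L, hL⟩ := ((h.down_small hint hmean hδ).eventually (gt_mem_nhds hδ)).exists
  refine ⟨L + 1, ?_⟩
  filter_upwards [(h.G_small hint hmean).eventually (gt_mem_nhds (show (0:ℝ) < 1 / 2 by norm_num))]
    with x hx
  have hpos : 0 ≤ 1 - δ - μ.real (E ξ x) := by linarith
  rw [← tsum_mul_left]
  refine Real.tsum_le_of_sum_range_le (fun n => mul_nonneg hpos measureReal_nonneg) fun N => ?_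
  set A : ℕ → Set Ω := fun n => {ω | ∀ j < n + 1, W ξ j ω ≤ x} ∩ {ω | - S ξ n ω - δ * n ≤ L}
  set B : ℕ → Set Ω := fun n => {ω | x + (L + 1) + (1 + δ) * n < ξ n ω}
  have hAp : ∀ n, MeasurableSet[past ξ n] (A n) := by
    intro n
    refine @MeasurableSet.inter _ (past ξ n) _ _ (measurableSet_all fun j hj => ?_) ?_
    · exact meas_sub_const
        (S_meas fun i hi => past_meas ξ (hi.trans_le (Nat.lt_succ_iff.1 hj))) _
    · have : Measurable[past ξ n] (fun ω => - S ξ n ω - δ * n) :=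
        meas_neg_sub_const (S_meas fun i hi => past_meas ξ hi) _
      exact this measurableSet_Iic
  have hBf : ∀ n, MeasurableSet[fut ξ n] (B n) := by
    intro n
    exact fut_meas ξ le_rfl measurableSet_Ioi
  have hAm : ∀ n, MeasurableSet (A n) := by
    intro n
    refine MeasurableSet.inter (measurableSet_all fun j hj => ?_) ?_
    · exact (S_meas fun i hi => h.meas i).sub_const _
    · exact measurableSet_le ((S_meas fun i hi => h.meas i).neg.sub_const _) measurable_const
  have hBm : ∀ n, MeasurableSet (B n) := fun n => h.meas n measurableSet_Ioi
  have hsub : ∀ n, A n ∩ B n ⊆ firstP (W ξ) x (n + 1) := by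
    rintro n ω ⟨⟨h1, h2⟩, h3⟩
    refine ⟨h1, ?_⟩
    have h2' : - S ξ n ω - δ * n ≤ L := h2
    have h3' : x + (L + 1) + (1 + δ) * n < ξ n ω := h3
    have : W ξ (n + 1) ω = S ξ n ω + ξ n ω - (n + 1) := by
      simp [W, S, Finset.sum_range_succ]
    rw [this]; linarith
  have hdisj : Pairwise (Function.onFun Disjoint fun n => A n ∩ B n) := by
    intro m n hmn
    exact (firstP_disjoint (W ξ) x (by simpa using hmn : m + 1 ≠ n + 1)).mono (hsub m) (hsub n)
  have hAn : ∀ n, 1 - δ - μ.real (E ξ x) ≤ μ.real (A n) := by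
    intro n
    have h1 : (A n)ᶜ ⊆ E ξ x ∪ {ω | ∃ n : ℕ, L < - S ξ n ω - δ * n} := by
      intro ω hω
      by_contra hcon
      simp only [mem_union, not_or, E, mem_ofPred_eq, not_exists, not_lt] at hcon
      exact hω ⟨fun j _ => hcon.1 j, hcon.2 n⟩
    have h2 := (measureReal_mono (μ := μ) h1).trans (measureReal_union_le _ _)
    rw [probReal_compl_eq_one_sub (hAm n)] at h2
    linarith
  calc ∑ i ∈ Finset.range N, (1 - δ - μ.real (E ξ x)) *
        μ.real {ω | x + (L + 1) + (1 + δ) * i < ξ 0 ω}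
      ≤ ∑ i ∈ Finset.range N, μ.real (A i ∩ B i) := by
        refine Finset.sum_le_sum fun i _ => ?_
        have e : μ.real (A i ∩ B i) =
            μ.real (A i) * μ.real {ω | x + (L + 1) + (1 + δ) * i < ξ 0 ω} := by
          simp only [Measure.real]
          rw [h.inter i (hAp i) (hBf i), ENNReal.toReal_mul, h.tail i]
        rw [e]
        exact mul_le_mul_of_nonneg_right (hAn i) measureReal_nonneg
    _ = μ.real (⋃ i ∈ Finset.range N, A i ∩ B i) :=
        (measureReal_biUnion_finset (fun i _ j _ hij => hdisj hij)
          (fun i _ => (hAm i).inter (hBm i))).symm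
    _ ≤ μ.real (E ξ x) := by
        refine measureReal_mono ?_
        intro ω hω
        simp only [mem_iUnion] at hω
        obtain ⟨i, _, hi⟩ := hω
        exact ⟨i + 1, (hsub i hi).2⟩

theorem IID.upper {ξ : ℕ → Ω → ℝ} (h : IID ξ μ) (hint : Integrable (ξ 0) μ)
    (hmean : ∫ ω, ξ 0 ω ∂μ = 0) {α : ℝ} (hα : 1 < α) (hF : RV (fun x => μ.real {ω | x < ξ 0 ω}) α)
    (η : ℝ) (hη : 0 < η) (hη2 : η < 1 / 2) :
    ∃ r : ℝ, ∀ᶠ x in atTop,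
      μ.real (E ξ x) ≤ (∑' n : ℕ, μ.real {ω | (1 - η) * x + r + (1 - η) * n < ξ 0 ω})
        + η * μ.real (E ξ ((1 - η) * x)) + μ.real (E ξ (η * x)) * μ.real (E ξ (η * x)) := by
  obtain ⟨r, hr, hr0⟩ := (((h.up_small hint hmean hη).eventually (gt_mem_nhds hη)).and
    (eventually_ge_atTop 0)).exists
  refine ⟨1 - r, ?_⟩
  filter_upwards [hF.summable hα (b := 1 - η) (by linarith) (c := 1 - η) (by linarith) (1 - r),
    eventually_ge_atTop r] with x hsum hxr
  set f : ℕ → Ω → ℝ := fun n ω => S ξ n ω - η * n with hf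
  set T : ℕ → Set Ω := fun n => firstP f r (n + 1) with hT
  have hSp : ∀ n j, j ≤ n → Measurable[past ξ n] (S ξ j) := fun n j hj =>
    S_meas fun i hi => past_meas ξ (hi.trans_le hj)
  have hTp : ∀ n, MeasurableSet[past ξ (n + 1)] (T n) := by
    intro n
    refine measurableSet_firstP fun j hj => ?_
    exact meas_sub_const (hSp _ _ hj) _
  have hWp : ∀ n (y : ℝ), MeasurableSet[past ξ n] {ω | y < W ξ n ω} := by
    intro n y
    have : Measurable[past ξ n] (W ξ n) :=
      meas_sub_const (hSp _ _ le_rfl) _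
    exact this measurableSet_Ioi
  have hEf : ∀ n (y : ℝ), MeasurableSet[fut ξ n] (E (fun i => ξ (n + i)) y) := fun n y =>
    E_meas (fun i => fut_meas ξ (Nat.le_add_right n i)) y
  have hSm : ∀ j, Measurable (S ξ j) := fun j => S_meas fun i _ => h.meas i
  have hTm : ∀ n, MeasurableSet (T n) := fun n =>
    measurableSet_firstP fun j hj => (hSm j).sub_const _
  have hWm : ∀ n (y : ℝ), MeasurableSet {ω | y < W ξ n ω} := fun n y =>
    ((hSm n).sub_const _) measurableSet_Ioi
  have hTd : Pairwise (Function.onFun Disjoint T) := by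
    intro m n hmn
    exact firstP_disjoint f r (by simpa using hmn : m + 1 ≠ n + 1)
  have hcover : E ξ x ⊆ ⋃ n, ((T n ∩ {ω | (1 - η) * x < W ξ (n + 1) ω}) ∪
      (T n ∩ E (fun i => ξ (n + 1 + i)) ((1 - η) * x))) ∪
      ((T n ∩ {ω | η * x < W ξ (n + 1) ω}) ∩ E (fun i => ξ (n + 1 + i)) (η * x)) := by
    rintro ω ⟨m, hm⟩
    have hm' : x < S ξ m ω - m := hm
    have hfm : r < f m ω := by
      simp only [hf]
      have : (0:ℝ) ≤ m := Nat.cast_nonneg m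
      nlinarith
    obtain ⟨n, hnm, hn⟩ := exists_firstP hfm
    obtain ⟨n, rfl⟩ : ∃ k, n = k + 1 := by
      cases n with
      | zero =>
        exfalso
        have := hn.2
        simp [hf, S] at this
        linarith
      | succ k => exact ⟨k, rfl⟩
    obtain ⟨k, rfl⟩ := Nat.exists_eq_add_of_le hnm
    refine mem_iUnion.2 ⟨n, ?_⟩
    have hsplit : W ξ (n + 1 + k) ω = W ξ (n + 1) ω + W (fun i => ξ (n + 1 + i)) k ω := by
      simp only [W, S, Finset.sum_range_add]
      push_cast; ring
    have hm2 : x < W ξ (n + 1 + k) ω := hm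
    rw [hsplit] at hm2
    by_cases c1 : (1 - η) * x < W ξ (n + 1) ω
    · exact Or.inl (Or.inl ⟨hn, c1⟩)
    by_cases c2 : (1 - η) * x < W (fun i => ξ (n + 1 + i)) k ω
    · exact Or.inl (Or.inr ⟨hn, k, c2⟩)
    refine Or.inr ⟨⟨hn, ?_⟩, k, ?_⟩
    · simp only [mem_ofPred_eq]; linarith
    · linarith
  have hT_le : ∑' n, μ (T n) ≤ ENNReal.ofReal η := by
    refine (tsum_meas_le_meas_iUnion_of_disjoint μ hTm hTd).trans ?_
    have h1 : (⋃ n, T n) ⊆ {ω | ∃ n : ℕ, r < S ξ n ω - η * n} := by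
      intro ω hω
      obtain ⟨n, hn⟩ := mem_iUnion.1 hω
      exact ⟨n + 1, hn.2⟩
    refine (measure_mono h1).trans ?_
    rw [← ENNReal.ofReal_toReal (measure_ne_top μ _)]
    exact ENNReal.ofReal_le_ofReal hr.le
  have hH2 : ∑' n, μ (T n ∩ {ω | η * x < W ξ (n + 1) ω}) ≤ μ (E ξ (η * x)) := by
    refine (tsum_meas_le_meas_iUnion_of_disjoint μ (fun n => (hTm n).inter (hWm _ _))
      (fun m n hmn => (hTd hmn).mono inter_subset_left inter_subset_left)).trans ?_
    refine measure_mono fun ω hω => ?_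
    obtain ⟨n, hn⟩ := mem_iUnion.1 hω
    exact ⟨n + 1, hn.2⟩
  have hH1 : ∑' n, μ (T n ∩ {ω | (1 - η) * x < W ξ (n + 1) ω}) ≤
      ENNReal.ofReal (∑' n : ℕ, μ.real {ω | (1 - η) * x + (1 - r) + (1 - η) * n < ξ 0 ω}) := by
    rw [ENNReal.ofReal_tsum_of_nonneg (fun n => measureReal_nonneg) hsum]
    refine ENNReal.tsum_le_tsum fun n => ?_
    rw [ofReal_measureReal, ← h.tail n]
    refine measure_mono ?_
    rintro ω ⟨h1, h2⟩
    have h3 := h1.1 n (Nat.lt_succ_self n)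
    have h2' : (1 - η) * x < W ξ (n + 1) ω := h2
    have : W ξ (n + 1) ω = S ξ n ω + ξ n ω - (n + 1) := by
      simp [W, S, Finset.sum_range_succ]
    rw [this] at h2'
    simp only [hf] at h3
    simp only [mem_ofPred_eq]
    linarith
  have hmain : μ (E ξ x) ≤
      ENNReal.ofReal (∑' n : ℕ, μ.real {ω | (1 - η) * x + (1 - r) + (1 - η) * n < ξ 0 ω}) +
      ENNReal.ofReal η * μ (E ξ ((1 - η) * x)) + μ (E ξ (η * x)) * μ (E ξ (η * x)) := by
    calc μ (E ξ x) ≤ ∑' n, (μ (T n ∩ {ω | (1 - η) * x < W ξ (n + 1) ω}) +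
          μ (T n) * μ (E ξ ((1 - η) * x)) +
          μ (T n ∩ {ω | η * x < W ξ (n + 1) ω}) * μ (E ξ (η * x))) := by
          refine (measure_mono hcover).trans ((measure_iUnion_le _).trans
            (ENNReal.tsum_le_tsum fun n => ?_))
          refine (measure_union_le _ _).trans (add_le_add ((measure_union_le _ _).trans
            (add_le_add le_rfl ?_)) ?_)
          · rw [h.inter (n + 1) (hTp n) (hEf (n + 1) _), h.E_shift]
          · rw [h.inter (n + 1) (@MeasurableSet.inter _ (past ξ (n + 1)) _ _ (hTp n)
              (hWp (n + 1) _)) (hEf (n + 1) _), h.E_shift]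
      _ = ∑' n, μ (T n ∩ {ω | (1 - η) * x < W ξ (n + 1) ω}) +
          (∑' n, μ (T n)) * μ (E ξ ((1 - η) * x)) +
          (∑' n, μ (T n ∩ {ω | η * x < W ξ (n + 1) ω})) * μ (E ξ (η * x)) := by
          rw [ENNReal.tsum_add, ENNReal.tsum_add, ENNReal.tsum_mul_right, ENNReal.tsum_mul_right]
      _ ≤ _ := by gcongr
  have hfin := ENNReal.toReal_mono (by finiteness) hmain
  rw [ENNReal.toReal_add (by finiteness) (by finiteness),
    ENNReal.toReal_add (by finiteness) (by finiteness), ENNReal.toReal_mul, ENNReal.toReal_mul,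
    ENNReal.toReal_ofReal (tsum_nonneg fun n => measureReal_nonneg),
    ENNReal.toReal_ofReal hη.le] at hfin
  exact hfin

theorem IID.main {ξ : ℕ → Ω → ℝ} (h : IID ξ μ) (hint : Integrable (ξ 0) μ)
    (hmean : ∫ ω, ξ 0 ω ∂μ = 0) {α : ℝ} (hα : 1 < α)
    (hF : RV (fun x => μ.real {ω | x < ξ 0 ω}) α) :
    Tendsto (fun x => μ.real (E ξ x) / (x * μ.real {ω | x < ξ 0 ω})) atTop
      (nhds (1 / (α - 1))) := by
  rw [tendsto_order]
  refine ⟨fun K hK => hF.lower hα (h.G_small hint hmean) (h.lower hint hmean) hK, ?_⟩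
  intro K hK
  obtain ⟨K', h1, h2⟩ := exists_between hK
  exact (hF.upper hα (fun _ => measureReal_nonneg) (fun _ => measureReal_le_one)
    (h.G_small hint hmean) (h.upper hint hmean hα hF) h1).mono fun x hx => hx.trans_lt h2

end prob

section levy

variable {Ω : Type*} [MeasurableSpace Ω] {μ : Measure Ω} [IsProbabilityMeasure μ]

/-- Lévy process data -/
structure Levy (X : ℝ → Ω → ℝ) (μ : Measure Ω) : Prop where
  meas : ∀ t : ℝ, Measurable (X t)
  zero : ∀ᵐ ω ∂μ, X 0 ω = 0
  path : ∀ᵐ ω ∂μ, ∀ t : ℝ, 0 ≤ t →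
      ContinuousWithinAt (fun s => X s ω) (Set.Ici t) t ∧
      (0 < t → ∃ l : ℝ, Tendsto (fun s => X s ω) (nhdsWithin t (Set.Iio t)) (nhds l))
  stat : ∀ s t : ℝ, 0 ≤ s → s ≤ t →
      Measure.map (fun ω => X t ω - X s ω) μ = Measure.map (X (t - s)) μ
  incr : ∀ (n : ℕ) (t : Fin (n + 1) → ℝ), (∀ i, 0 ≤ t i) → StrictMono t →
      iIndepFun
        (fun i : Fin n => fun ω => X (t i.succ) ω - X (t i.castSucc) ω) μ

/-- grid increments -/
def inc (X : ℝ → Ω → ℝ) (h : ℝ) (i : ℕ) (ω : Ω) : ℝ := X ((i + 1 : ℕ) * h) ω - X (i * h) ω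

theorem S_inc (X : ℝ → Ω → ℝ) (h : ℝ) (n : ℕ) (ω : Ω) :
    S (inc X h) n ω = X (n * h) ω - X 0 ω := by
  have := Finset.sum_range_sub (fun i : ℕ => X (i * h) ω) n
  simpa [S, inc] using this

theorem Levy.iid {X : ℝ → Ω → ℝ} (hX : Levy X μ) {h : ℝ} (hh : 0 < h) : IID (inc X h) μ where
  meas i := (hX.meas _).sub (hX.meas _)
  indep := by
    refine iIndepFun_iff_finset.2 fun s => ?_
    obtain ⟨N, hN⟩ : ∃ N, ∀ x ∈ s, x < N := by
      refine ⟨s.sup id + 1, fun x hx => ?_⟩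
      exact Nat.lt_succ_of_le (Finset.le_sup (f := id) hx)
    have h1 := hX.incr N (fun i => (i : ℕ) * h) (fun i => by positivity) (by
      intro a b hab
      have : ((a : ℕ) : ℝ) < (b : ℕ) := by exact_mod_cast hab
      exact mul_lt_mul_of_pos_right this hh)
    let g (x : s) : Fin N := ⟨x.1, hN x.1 x.2⟩
    have h2 := h1.precomp (g := g) (by intro x y hxy; exact Subtype.ext (congrArg Fin.val hxy))
    exact h2
  ident i := by
    have key : ∀ i : ℕ, μ.map (inc X h i) = μ.map (X h) := by
      intro i
      have := hX.stat (i * h) ((i + 1 : ℕ) * h) (by positivity) (by push_cast; nlinarith)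
      have e : ((i + 1 : ℕ) : ℝ) * h - i * h = h := by push_cast; ring
      rw [e] at this
      exact this
    rw [key, key]

/-- grid exceedance -/
def D (X : ℝ → Ω → ℝ) (k : ℕ) (v : ℝ) : Set Ω :=
  {ω | ∃ j : ℕ, v < S (inc X ((2:ℝ) ^ k)⁻¹) j ω - j * ((2:ℝ) ^ k)⁻¹}

theorem D_meas {X : ℝ → Ω → ℝ} (hX : ∀ t, Measurable (X t)) (k : ℕ) (v : ℝ) :
    MeasurableSet (D X k v) :=
  measurableSet_ex fun _ => (S_meas fun i _ => (hX _).sub (hX _)).sub_const _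

theorem Levy.ottaviani {X : ℝ → Ω → ℝ} (hX : Levy X μ) (k : ℕ) (u : ℝ) {c p : ℝ} (hp0 : 0 ≤ p)
    (hp : ∀ j : ℕ, j ≤ 2 ^ k → p ≤ μ.real {ω | -c ≤ X (j * ((2:ℝ) ^ k)⁻¹) ω -
      j * ((2:ℝ) ^ k)⁻¹}) :
    μ.real (D X k (u + c)) * p ≤ μ.real (E (inc X 1) u) := by
  set h : ℝ := ((2:ℝ) ^ k)⁻¹ with hh
  have hhpos : 0 < h := by positivity
  have hid := hX.iid hhpos
  set ζ := inc X h with hζ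
  set f : ℕ → Ω → ℝ := fun j ω => S ζ j ω - j * h with hf
  set R : ℕ → Set Ω := firstP f (u + c) with hR
  set m : ℕ → ℕ := fun j => (j / 2 ^ k + 1) * 2 ^ k with hm
  have hjm : ∀ j, j ≤ m j := by
    intro j
    have := Nat.lt_div_mul_add (a := j) (b := 2 ^ k) (by positivity)
    simp only [hm, add_mul, one_mul]; omega
  have hmj : ∀ j, m j - j ≤ 2 ^ k := by
    intro j
    have := Nat.div_mul_le_self j (2 ^ k)
    simp only [hm, add_mul, one_mul]
    generalize j / 2 ^ k * 2 ^ k = a at *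
    generalize 2 ^ k = b at *
    omega
  have hmh : ∀ j, (m j : ℝ) * h = ((j / 2 ^ k + 1 : ℕ) : ℝ) := by
    intro j
    simp only [hm, hh]; push_cast; field_simp
  set B : ℕ → Set Ω := fun j => {ω | -c ≤ X (m j * h) ω - X (j * h) ω - (m j - j : ℕ) * h} with hB
  have hRp : ∀ j, MeasurableSet[past ζ j] (R j) := by
    intro j
    refine measurableSet_firstP fun i hi => ?_
    exact meas_sub_const (S_meas fun l hl => past_meas ζ (hl.trans_le hi)) _
  have hRm : ∀ j, MeasurableSet (R j) := by
    intro j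
    refine measurableSet_firstP fun i hi => ?_
    exact meas_sub_const (S_meas fun l hl => hid.meas l) _
  have hBf : ∀ j, MeasurableSet[fut ζ j] (B j) := by
    intro j
    have e : (fun ω => X (m j * h) ω - X (j * h) ω) =
        fun ω => ∑ i ∈ Finset.Ico j (m j), ζ i ω := by
      funext ω
      exact (Finset.sum_Ico_sub (fun i : ℕ => X (i * h) ω) (hjm j)).symm
    have h1 : Measurable[fut ζ j] (fun ω => X (m j * h) ω - X (j * h) ω) := by
      rw [e]
      exact Finset.measurable_sum _ fun i hi => fut_meas ζ (Finset.mem_Ico.1 hi).1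
    exact (meas_sub_const h1 _) measurableSet_Ici
  have hBm : ∀ j, MeasurableSet (B j) := fun j =>
    (((hX.meas _).sub (hX.meas _)).sub_const _) measurableSet_Ici
  have hBp : ∀ j, ENNReal.ofReal p ≤ μ (B j) := by
    intro j
    have h1 := hX.stat (j * h) (m j * h) (by positivity)
      (mul_le_mul_of_nonneg_right (by exact_mod_cast hjm j) hhpos.le)
    have e : (m j : ℝ) * h - j * h = (m j - j : ℕ) * h := by
      rw [Nat.cast_sub (hjm j)]; ring
    rw [e] at h1
    have hs : MeasurableSet {y : ℝ | -c ≤ y - (m j - j : ℕ) * h} :=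
      (measurable_id.sub_const _) measurableSet_Ici
    have h2 := congrArg (fun ν => ν {y : ℝ | -c ≤ y - (m j - j : ℕ) * h}) h1
    beta_reduce at h2
    have hm1 : Measurable (fun ω => X (m j * h) ω - X (j * h) ω) := (hX.meas _).sub (hX.meas _)
    rw [Measure.map_apply hm1 hs, Measure.map_apply (hX.meas _) hs] at h2
    have h3 := hp (m j - j) (hmj j)
    have h4 : μ (B j) = μ {ω | -c ≤ X ((m j - j : ℕ) * h) ω - (m j - j : ℕ) * h} := h2
    rw [h4, ← ofReal_measureReal]
    exact ENNReal.ofReal_le_ofReal h3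
  have hsub : ∀ j, R j ∩ B j ⊆ E (inc X 1) u := by
    rintro j ω ⟨h1, h2⟩
    refine ⟨j / 2 ^ k + 1, ?_⟩
    have h3 : u + c < S ζ j ω - j * h := h1.2
    have h4 : -c ≤ X (m j * h) ω - X (j * h) ω - (m j - j : ℕ) * h := h2
    rw [S_inc] at h3
    rw [Nat.cast_sub (hjm j), sub_mul, hmh j] at h4
    simp only [W, S_inc, mul_one]
    linarith
  have hdisj : Pairwise (Function.onFun Disjoint fun j => R j ∩ B j) := fun i j hij =>
    (firstP_disjoint f (u + c) hij).mono inter_subset_left inter_subset_left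
  have hmain : μ (D X k (u + c)) * ENNReal.ofReal p ≤ μ (E (inc X 1) u) := by
    have h1 : D X k (u + c) ⊆ ⋃ j, R j := by
      rintro ω ⟨j, hj⟩
      obtain ⟨n, _, hn⟩ := exists_firstP (f := f) hj
      exact mem_iUnion.2 ⟨n, hn⟩
    calc μ (D X k (u + c)) * ENNReal.ofReal p ≤ (∑' j, μ (R j)) * ENNReal.ofReal p := by
          gcongr; exact (measure_mono h1).trans (measure_iUnion_le _)
      _ = ∑' j, μ (R j) * ENNReal.ofReal p := ENNReal.tsum_mul_right.symm
      _ ≤ ∑' j, μ (R j ∩ B j) := by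
          refine ENNReal.tsum_le_tsum fun j => ?_
          rw [hid.inter j (hRp j) (hBf j)]
          gcongr; exact hBp j
      _ ≤ μ (⋃ j, R j ∩ B j) :=
          tsum_meas_le_meas_iUnion_of_disjoint μ (fun j => (hRm j).inter (hBm j)) hdisj
      _ ≤ _ := measure_mono (iUnion_subset hsub)
  have := ENNReal.toReal_mono (by finiteness) hmain
  rwa [ENNReal.toReal_mul, ENNReal.toReal_ofReal hp0] at this

theorem path_bdd {f : ℝ → ℝ} (hf : ∀ t : ℝ, 0 ≤ t →
      ContinuousWithinAt f (Set.Ici t) t ∧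
      (0 < t → ∃ l : ℝ, Tendsto f (nhdsWithin t (Set.Iio t)) (nhds l))) :
    ∃ C : ℝ, ∀ x ∈ Icc (0:ℝ) 1, C ≤ f x := by
  refine isCompact_Icc.induction_on (p := fun s => ∃ C : ℝ, ∀ x ∈ s, C ≤ f x) ⟨0, by simp⟩
    (fun s t hst ⟨C, hC⟩ => ⟨C, fun x hx => hC x (hst hx)⟩) ?_ ?_
  · rintro s t ⟨C, hC⟩ ⟨C', hC'⟩
    refine ⟨min C C', ?_⟩
    rintro x (hx | hx)
    · exact (min_le_left _ _).trans (hC x hx)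
    · exact (min_le_right _ _).trans (hC' x hx)
  · intro t ht
    have h1 : ∀ᶠ s in nhdsWithin t (Ici t), f t - 1 ≤ f s :=
      ((hf t ht.1).1.eventually (lt_mem_nhds (sub_one_lt (f t)))).mono fun s hs => hs.le
    rcases eq_or_lt_of_le ht.1 with h0 | h0
    · refine ⟨{s | f t - 1 ≤ f s}, ?_, f t - 1, fun x hx => hx⟩
      subst h0
      exact nhdsWithin_mono _ (fun x hx => hx.1) h1
    · obtain ⟨l, hl⟩ := (hf t ht.1).2 h0
      have h2 : ∀ᶠ s in nhdsWithin t (Iio t), l - 1 ≤ f s :=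
        (hl.eventually (lt_mem_nhds (sub_one_lt l))).mono fun s hs => hs.le
      refine ⟨{s | min (f t - 1) (l - 1) ≤ f s}, ?_, _, fun x hx => hx⟩
      refine nhdsWithin_le_nhds ?_
      rw [← nhdsLT_sup_nhdsGE]
      exact ⟨h2.mono fun s hs => (min_le_right _ _).trans hs,
        h1.mono fun s hs => (min_le_left _ _).trans hs⟩

theorem Levy.tight {X : ℝ → Ω → ℝ} (hX : Levy X μ) {p : ℝ} (hp : p < 1) :
    ∃ c : ℝ, ∀ k j : ℕ, j ≤ 2 ^ k → p ≤ μ.real {ω | -c ≤ X (j * ((2:ℝ) ^ k)⁻¹) ω -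
      j * ((2:ℝ) ^ k)⁻¹} := by
  have h1 := tail_small (μ := μ) (ι := {q : ℕ × ℕ // q.2 ≤ 2 ^ q.1})
    (f := fun q ω => -(X (q.1.2 * ((2:ℝ) ^ q.1.1)⁻¹) ω - q.1.2 * ((2:ℝ) ^ q.1.1)⁻¹))
    (fun q => ((hX.meas _).sub_const _).neg) (by
      filter_upwards [hX.path] with ω hω
      obtain ⟨C, hC⟩ := path_bdd hω
      refine ⟨-C + 1, ?_⟩
      rintro _ ⟨⟨⟨k, j⟩, hq⟩, rfl⟩
      simp only at hq ⊢
      have hle : (j : ℝ) * ((2:ℝ) ^ k)⁻¹ ≤ 1 := by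
        rw [← div_eq_mul_inv, div_le_one (by positivity)]
        exact_mod_cast hq
      have := hC _ ⟨by positivity, hle⟩
      linarith)
  obtain ⟨c, hc⟩ := (h1.eventually (gt_mem_nhds (sub_pos.2 hp))).exists
  refine ⟨c, fun k j hj => ?_⟩
  have hm : MeasurableSet {ω | -c ≤ X (j * ((2:ℝ) ^ k)⁻¹) ω - j * ((2:ℝ) ^ k)⁻¹} :=
    ((hX.meas _).sub_const _) measurableSet_Ici
  have hsub : {ω | -c ≤ X (j * ((2:ℝ) ^ k)⁻¹) ω - j * ((2:ℝ) ^ k)⁻¹}ᶜ ⊆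
      {ω | ∃ q : {q : ℕ × ℕ // q.2 ≤ 2 ^ q.1},
        c < -(X (q.1.2 * ((2:ℝ) ^ q.1.1)⁻¹) ω - q.1.2 * ((2:ℝ) ^ q.1.1)⁻¹)} := by
    intro ω hω
    have hω' : ¬ (-c ≤ X (j * ((2:ℝ) ^ k)⁻¹) ω - j * ((2:ℝ) ^ k)⁻¹) := hω
    refine ⟨⟨(k, j), hj⟩, ?_⟩
    simp only
    linarith
  have h2 := measureReal_mono (μ := μ) hsub
  rw [probReal_compl_eq_one_sub hm] at h2
  linarith

theorem D_mono (X : ℝ → Ω → ℝ) (v : ℝ) : Monotone (fun k => D X k v) := by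
  refine monotone_nat_of_le_succ fun k => ?_
  rintro ω ⟨j, hj⟩
  refine ⟨2 * j, ?_⟩
  rw [S_inc] at hj ⊢
  have e : ((2 * j : ℕ) : ℝ) * ((2:ℝ) ^ (k + 1))⁻¹ = j * ((2:ℝ) ^ k)⁻¹ := by
    push_cast; rw [pow_succ]; field_simp
  rw [e]; exact hj

theorem Levy.union_bound {X : ℝ → Ω → ℝ} (hX : Levy X μ) {p : ℝ} (hp0 : 0 ≤ p) (hp : p < 1) :
    ∃ c : ℝ, ∀ u, μ.real (⋃ k, D X k (u + c)) * p ≤ μ.real (E (inc X 1) u) := by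
  obtain ⟨c, hc⟩ := hX.tight hp
  refine ⟨c, fun u => ?_⟩
  have h1 := tendsto_measure_iUnion_atTop (μ := μ) (D_mono X (u + c))
  have h2 := (ENNReal.tendsto_toReal (measure_ne_top μ _)).comp h1
  exact le_of_tendsto (h2.mul_const p)
    (Eventually.of_forall fun k => hX.ottaviani k u hp0 (hc k))

theorem Levy.main {X : ℝ → Ω → ℝ} (hX : Levy X μ) (hint : Integrable (X 1) μ)
    (hmean : ∫ ω, X 1 ω ∂μ = 0) {α : ℝ} (hα : 1 < α)
    (hF : RV (fun x => μ.real {ω | x < X 1 ω}) α) :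
    Tendsto (fun u => μ.real (⋃ k, D X k u) / (u * μ.real {ω | u < X 1 ω})) atTop
      (nhds (1 / (α - 1))) ∧ Tendsto (fun u => μ.real (⋃ k, D X k u)) atTop (nhds 0) := by
  have hid := hX.iid one_pos
  have hlaw : IdentDistrib (inc X 1 0) (X 1) μ μ := by
    refine ⟨(hid.meas 0).aemeasurable, (hX.meas 1).aemeasurable, ?_⟩
    have := hX.stat 0 1 le_rfl zero_le_one
    rw [sub_zero] at this
    rw [← this]
    congr 1
    funext ω
    simp [inc]
  have hFeq : (fun x => μ.real {ω | x < inc X 1 0 ω}) = fun x => μ.real {ω | x < X 1 ω} := by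
    funext x
    exact congrArg ENNReal.toReal (hlaw.measure_mem_eq (measurableSet_Ioi (a := x)))
  have hF' : RV (fun x => μ.real {ω | x < inc X 1 0 ω}) α := by rw [hFeq]; exact hF
  have hint' : Integrable (inc X 1 0) μ := hlaw.integrable_iff.2 hint
  have hmean' : ∫ ω, inc X 1 0 ω ∂μ = 0 := by rw [hlaw.integral_eq, hmean]
  have hG0 := hid.G_small hint' hmean'
  have hmain := hid.main hint' hmean' hα hF'
  set F : ℝ → ℝ := fun x => μ.real {ω | x < X 1 ω} with hFdef
  have hmain' : Tendsto (fun x => μ.real (E (inc X 1) x) / (x * F x)) atTop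
      (nhds (1 / (α - 1))) := by
    refine hmain.congr fun x => ?_
    rw [← congrFun hFeq x]
  have hα1 : 0 < α - 1 := by linarith
  constructor
  · rw [tendsto_order]
    constructor
    · intro K hK
      filter_upwards [hmain'.eventually (lt_mem_nhds hK), eventually_gt_atTop 0] with u hu hu0
      refine hu.trans_le (div_le_div_of_nonneg_right (measureReal_mono ?_)
        (mul_pos hu0 (hF.pos u)).le)
      refine subset_trans ?_ (subset_iUnion _ 0)
      rintro ω ⟨n, hn⟩
      refine ⟨n, ?_⟩
      simpa [W, S_inc] using hn
    · intro K hK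
      have hpe : ∀ᶠ p in nhdsWithin (1:ℝ) (Iio 1), 1 / (α - 1) < K * p := by
        refine nhdsWithin_le_nhds ?_
        have : ContinuousAt (fun p : ℝ => K * p) 1 := by fun_prop
        exact this.eventually (lt_mem_nhds (by simpa using hK))
      have hpe0 : ∀ᶠ p in nhdsWithin (1:ℝ) (Iio 1), 0 < p :=
        nhdsWithin_le_nhds (lt_mem_nhds one_pos)
      obtain ⟨p, ⟨hp1, hp0⟩, hp2⟩ := ((hpe.and hpe0).and self_mem_nhdsWithin).exists
      obtain ⟨c, hc⟩ := hX.union_bound hp0.le hp2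
      have ht : Tendsto (fun x : ℝ => 1 * x + -c) atTop atTop :=
        tendsto_atTop_add_const_right _ _ (tendsto_id.const_mul_atTop one_pos)
      have h1 := (hmain'.comp ht).mul (hF.A_asymp one_pos (-c))
      rw [Real.one_rpow, mul_one] at h1
      filter_upwards [h1.eventually (gt_mem_nhds hp1), eventually_gt_atTop 0,
        ht.eventually (eventually_gt_atTop 0)] with u hu hu0 hu1
      have h2 := hc (1 * u + -c)
      have e : 1 * u + -c + c = u := by ring
      rw [e] at h2
      have p1 := hF.pos u
      have p2 := hF.pos (1 * u + -c)
      have A0 : 0 < u * F u := mul_pos hu0 p1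
      have A1 : 0 < (1 * u + -c) * F (1 * u + -c) := mul_pos hu1 p2
      simp only [Function.comp] at hu
      rw [div_mul_div_cancel₀ A1.ne', div_lt_iff₀ A0] at hu
      rw [div_lt_iff₀ A0]
      have : μ.real (⋃ k, D X k u) * p < K * (u * F u) * p := by
        refine h2.trans_lt (hu.trans_eq (by ring))
      exact lt_of_mul_lt_mul_right this hp0.le
  · obtain ⟨c, hc⟩ := hX.union_bound (p := 1 / 2) (by norm_num) (by norm_num)
    have ht : Tendsto (fun x : ℝ => x - c) atTop atTop :=
      tendsto_atTop_add_const_right _ _ tendsto_id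
    have h1 := (hG0.comp ht).const_mul 2
    rw [mul_zero] at h1
    refine squeeze_zero (fun _ => measureReal_nonneg) (fun u => ?_) h1
    have := hc (u - c)
    rw [sub_add_cancel] at this
    simp only [Function.comp]
    linarith

theorem mem_D_iff {X : ℝ → Ω → ℝ} {ω : Ω} (h0 : X 0 ω = 0)
    (hp : ∀ t : ℝ, 0 ≤ t → ContinuousWithinAt (fun s => X s ω) (Set.Ici t) t) (v : ℝ) :
    ω ∈ (⋃ k, D X k v) ↔ ∃ r : {r : ℝ // 0 ≤ r}, v < X (r : ℝ) ω - r := by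
  constructor
  · intro h
    obtain ⟨k, j, hj⟩ := mem_iUnion.1 h
    rw [S_inc, h0, sub_zero] at hj
    exact ⟨⟨j * ((2:ℝ) ^ k)⁻¹, by positivity⟩, hj⟩
  · rintro ⟨⟨t, ht⟩, h⟩
    simp only at h
    have hc : ContinuousWithinAt (fun s => X s ω - s) (Ici t) t :=
      (hp t ht).sub continuousWithinAt_id
    have he : ∀ᶠ s in nhdsWithin t (Ici t), v < X s ω - s := hc.eventually (lt_mem_nhds h)
    -- dyadic approximations from the right
    have hpow : Tendsto (fun k : ℕ => ((2:ℝ) ^ k)⁻¹) atTop (nhds 0) := by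
      have := tendsto_pow_atTop_nhds_zero_of_lt_one (r := (2:ℝ)⁻¹) (by norm_num) (by norm_num)
      simpa [inv_pow] using this
    have hge : ∀ k : ℕ, t ≤ (⌈t * 2 ^ k⌉₊ : ℝ) * ((2:ℝ) ^ k)⁻¹ := by
      intro k
      rw [← div_eq_mul_inv, le_div_iff₀ (by positivity)]
      exact Nat.le_ceil _
    have hle : ∀ k : ℕ, (⌈t * 2 ^ k⌉₊ : ℝ) * ((2:ℝ) ^ k)⁻¹ ≤ t + ((2:ℝ) ^ k)⁻¹ := by
      intro k
      have h1 := (Nat.ceil_lt_add_one (a := t * 2 ^ k) (by positivity)).le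
      have h2 := mul_le_mul_of_nonneg_right h1 (show (0:ℝ) ≤ ((2:ℝ) ^ k)⁻¹ by positivity)
      refine h2.trans_eq ?_
      field_simp
    have hlim : Tendsto (fun k : ℕ => (⌈t * 2 ^ k⌉₊ : ℝ) * ((2:ℝ) ^ k)⁻¹) atTop
        (nhdsWithin t (Ici t)) := by
      refine tendsto_nhdsWithin_iff.2 ⟨?_, Eventually.of_forall hge⟩
      have h2 : Tendsto (fun k : ℕ => t + ((2:ℝ) ^ k)⁻¹) atTop (nhds t) := by
        simpa using hpow.const_add t
      exact tendsto_of_tendsto_of_tendsto_of_le_of_le tendsto_const_nhds h2 hge hle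
    obtain ⟨k, hk⟩ := (hlim.eventually he).exists
    refine mem_iUnion.2 ⟨k, ⌈t * 2 ^ k⌉₊, ?_⟩
    rw [S_inc, h0, sub_zero]
    exact hk

theorem Levy.final {X : ℝ → Ω → ℝ} (hX : Levy X μ)
    (h0 : Tendsto (fun u => μ.real (⋃ k, D X k u)) atTop (nhds 0)) :
    AEMeasurable (fun ω => ⨆ r : {r : ℝ // 0 ≤ r}, (X (r : ℝ) ω - (r : ℝ))) μ ∧
    ∀ u, μ {ω | u < ⨆ r : {r : ℝ // 0 ≤ r}, (X (r : ℝ) ω - (r : ℝ))} = μ (⋃ k, D X k u) := by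
  have hnull : μ (⋂ n : ℕ, ⋃ k, D X k (n : ℝ)) = 0 := by
    have h1 : μ.real (⋂ n : ℕ, ⋃ k, D X k (n : ℝ)) ≤ 0 := by
      refine ge_of_tendsto (h0.comp tendsto_natCast_atTop_atTop) (Eventually.of_forall fun n => ?_)
      exact measureReal_mono (iInter_subset _ n)
    exact (measureReal_eq_zero_iff).1 (le_antisymm h1 measureReal_nonneg)
  have hbd : ∀ᵐ ω ∂μ, ω ∉ ⋂ n : ℕ, ⋃ k, D X k (n : ℝ) := measure_eq_zero_iff_ae_notMem.1 hnull
  have hgood : ∀ᵐ ω ∂μ, ∀ u : ℝ,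
      u < (⨆ r : {r : ℝ // 0 ≤ r}, (X (r : ℝ) ω - (r : ℝ))) ↔ ω ∈ ⋃ k, D X k u := by
    filter_upwards [hbd, hX.zero, hX.path] with ω h1 h2 h3 u
    have hiff := mem_D_iff h2 (fun t ht => (h3 t ht).1)
    rw [hiff u]
    simp only [mem_iInter, not_forall] at h1
    obtain ⟨n, hn⟩ := h1
    rw [hiff] at hn
    push Not at hn
    haveI : Nonempty {r : ℝ // 0 ≤ r} := ⟨⟨0, le_rfl⟩⟩
    exact lt_ciSup_iff ⟨n, by rintro _ ⟨r, rfl⟩; exact hn r⟩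
  constructor
  · refine ⟨fun ω => ⨆ q : ℕ × ℕ, (S (inc X ((2:ℝ) ^ q.1)⁻¹) q.2 ω - q.2 * ((2:ℝ) ^ q.1)⁻¹),
      Measurable.iSup fun q => (S_meas fun i _ => (hX.meas _).sub (hX.meas _)).sub_const _, ?_⟩
    filter_upwards [hgood, hbd] with ω h1 h2
    refine eq_of_forall_lt_iff fun u => ?_
    rw [h1 u]
    simp only [mem_iInter, not_forall] at h2
    obtain ⟨n, hn⟩ := h2
    rw [lt_ciSup_iff]
    · constructor
      · intro h
        obtain ⟨k, j, hj⟩ := mem_iUnion.1 h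
        exact ⟨(k, j), hj⟩
      · rintro ⟨⟨k, j⟩, hj⟩
        exact mem_iUnion.2 ⟨k, j, hj⟩
    · refine ⟨n, ?_⟩
      rintro _ ⟨⟨k, j⟩, rfl⟩
      by_contra hcon
      exact hn (mem_iUnion.2 ⟨k, j, not_le.1 hcon⟩)
  · intro u
    refine measure_congr ?_
    filter_upwards [hgood] with ω h1
    exact propext (h1 u)

end levy

end Veraverbeke

/-- **Proposition 3.3 (ii)**: `P(Q_e > u) ∼ u/(α-1) · P(X(1) > u)`. -/
theorem stationary_workload_tail_asymptotics
    {Ω : Type*} [MeasureSpace Ω] [IsProbabilityMeasure (ℙ : Measure Ω)]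
    (X : ℝ → Ω → ℝ)
    (hmeas : ∀ t : ℝ, Measurable (X t))
    (hX0 : ∀ᵐ ω ∂ℙ, X 0 ω = 0)
    (hpath : ∀ᵐ ω ∂ℙ, ∀ t : ℝ, 0 ≤ t →
      ContinuousWithinAt (fun s => X s ω) (Set.Ici t) t ∧
      (0 < t → ∃ l : ℝ, Tendsto (fun s => X s ω) (nhdsWithin t (Set.Iio t)) (nhds l)))
    (hstat : ∀ s t : ℝ, 0 ≤ s → s ≤ t →
      Measure.map (fun ω => X t ω - X s ω) ℙ = Measure.map (X (t - s)) ℙ)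
    (hincr : ∀ (n : ℕ) (t : Fin (n + 1) → ℝ), (∀ i, 0 ≤ t i) → StrictMono t →
      iIndepFun
        (fun i : Fin n => fun ω => X (t i.succ) ω - X (t i.castSucc) ω) ℙ)
    (hint : Integrable (X 1) ℙ)
    (hmean : ∫ ω, X 1 ω ∂ℙ = 0)
    (Qe : Ω → ℝ) (hQe_meas : Measurable Qe)
    (hQe_dist : Measure.map Qe ℙ
      = Measure.map (fun ω => ⨆ r : {r : ℝ // 0 ≤ r}, (X (r : ℝ) ω - (r : ℝ))) ℙ)
    (hQe_indep : IndepFun Qe (fun ω => fun t : ℝ => X t ω) ℙ)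
    (α : ℝ) (hα : 1 < α)
    (htail_pos : ∀ x : ℝ, 0 < ℙ {ω | x < X 1 ω})
    (hRV : ∀ c : ℝ, 0 < c →
      Tendsto (fun x : ℝ =>
          (ℙ {ω | c * x < X 1 ω}).toReal / (ℙ {ω | x < X 1 ω}).toReal)
        atTop (nhds (c ^ (-α))))
    (hbal : α < 2 → ∃ ρ : ℝ, 0 ≤ ρ ∧
      Tendsto (fun x : ℝ =>
          (ℙ {ω | X 1 ω < -x}).toReal / (ℙ {ω | x < X 1 ω}).toReal)
        atTop (nhds ρ))
    :
    Tendsto (fun u : ℝ =>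
        (ℙ {ω | u < Qe ω}).toReal * (α - 1)
          / (u * (ℙ {ω | u < X 1 ω}).toReal))
      atTop (nhds 1) := by
  have hX : Veraverbeke.Levy X ℙ := ⟨hmeas, hX0, hpath, hstat, hincr⟩
  have hF : Veraverbeke.RV (fun x => (ℙ : Measure Ω).real {ω | x < X 1 ω}) α :=
    { anti := fun x y hxy => measureReal_mono fun ω hω => lt_of_le_of_lt hxy hω
      pos := fun x => ENNReal.toReal_pos (htail_pos x).ne' (measure_ne_top _ _)
      lim := hRV }
  obtain ⟨h1, h2⟩ := hX.main hint hmean hα hF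
  obtain ⟨h3, h4⟩ := hX.final h2
  have hα1 : α - 1 ≠ 0 := by linarith
  have h5 := h1.mul_const (α - 1)
  rw [one_div_mul_cancel hα1] at h5
  refine h5.congr fun u => ?_
  have h6 : ℙ {ω | u < Qe ω} = ℙ (⋃ k, Veraverbeke.D X k u) := by
    rw [← h4 u]
    have h7 := congrArg (fun ν => ν (Ioi u)) hQe_dist
    beta_reduce at h7
    rw [Measure.map_apply hQe_meas measurableSet_Ioi,
      Measure.map_apply_of_aemeasurable h3 measurableSet_Ioi] at h7
    exact h7
  rw [h6, div_mul_eq_mul_div]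
  rfl
end
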